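/- arXiv:1202.5896 — 7 statements merged into one kernel-verified Lean document; each statement's English description precedes it below -/
import Mathlib

section
/- Let m ≥ 2, let G be a subgroup of the symmetric group on {1,…,m} whose action on {1,…,m} is 2-transitive, let ε ∈ ℂ be a primitive m-th root of unity, and let n_1,…,n_m ∈ ℂ satisfy ∑_{i=1}^m n_{σ(i)} ε^i = 0 for every σ ∈ G. Then n_j = (∑_{k=1}^m n_k)/m for every j ∈ {1,…,m}; in particular, if moreover ∑_{k=1}^m n_k = 0, then n_j = 0 for all j. -/
open Finset in
/-- If `a` sums to zero, `a p ≠ 0`, and all `G`-translates of `n` are orthogonal to `a` for a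
2-transitive group `G`, then `n` is constant. The proof averages `a` over the stabilizer of `p`. -/
theorem card_mul_eq_sum_of_two_transitive {ι K : Type*} [Fintype ι] [Nontrivial ι]
    [Field K] [CharZero K] (G : Subgroup (Equiv.Perm ι))
    (h2t : ∀ i j k l : ι, i ≠ j → k ≠ l → ∃ σ ∈ G, σ i = k ∧ σ j = l)
    (a n : ι → K) (ha : ∑ i, a i = 0) (p : ι) (hp : a p ≠ 0)
    (hbal : ∀ σ ∈ G, ∑ i, n (σ i) * a i = 0) (j : ι) :
    (Fintype.card ι : K) * n j = ∑ k, n k := by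
  classical
  obtain ⟨q, hq⟩ := exists_ne p
  obtain ⟨k, hk⟩ := exists_ne j
  obtain ⟨σ, hσ, hσp, -⟩ := h2t p q j k hq.symm hk.symm
  let H : Finset (Equiv.Perm ι) := univ.filter fun h => h ∈ G ∧ h p = p
  have mem_H (h : Equiv.Perm ι) : h ∈ H ↔ h ∈ G ∧ h p = p := by simp [H]
  let b : ι → K := fun i => ∑ h ∈ H, a (h i)
  have hbp : b p = #H * a p := by
    rw [← nsmul_eq_mul, ← sum_const]
    exact sum_congr rfl fun h hh => by rw [((mem_H h).1 hh).2]
  have hH : (#H : K) ≠ 0 := by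
    rw [Nat.cast_ne_zero, card_ne_zero]
    exact ⟨1, (mem_H 1).2 ⟨G.one_mem, rfl⟩⟩
  have hb_const (i : ι) (hi : i ≠ p) : b i = b q := by
    obtain ⟨g, hg, hgp, hgq⟩ := h2t p q p i hq.symm hi.symm
    refine sum_equiv (Equiv.mulRight g) (fun h => ?_) fun h _ => by simp [hgq]
    simp [mem_H, G.mul_mem_cancel_right hg, hgp]
  have hb_split : ∀ f : ι → K, ∑ i, f i * b i = f p * b p + b q * (∑ i, f i - f p) := by
    intro f
    rw [← add_sum_erase _ _ (mem_univ p), ← add_sum_erase _ f (mem_univ p), add_sub_cancel_left,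
      mul_sum _ _ (b q)]
    congr 1
    exact sum_congr rfl fun i hi => by rw [hb_const i (ne_of_mem_erase hi), mul_comm]
  have hb_sum : ∑ i, 1 * b i = 0 := by
    simp only [one_mul, b]
    rw [sum_comm]
    exact sum_eq_zero fun h _ => (Equiv.sum_comp h a).trans ha
  have hb_bal : ∑ i, n (σ i) * b i = 0 := by
    simp only [b, mul_sum]
    rw [sum_comm]
    refine sum_eq_zero fun h hh => ?_
    rw [← hbal _ (G.mul_mem hσ (G.inv_mem ((mem_H h).1 hh).1)),
      ← Equiv.sum_comp h fun i => n ((σ * h⁻¹) i) * a i]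
    simp
  rw [hb_split fun _ => 1] at hb_sum
  rw [hb_split fun i => n (σ i), Equiv.sum_comp σ n, hσp] at hb_bal
  simp only [sum_const, card_univ, nsmul_eq_mul, mul_one, one_mul] at hb_sum
  have hbq : b q ≠ 0 := by
    intro h0
    rw [h0, zero_mul, add_zero, hbp] at hb_sum
    exact mul_ne_zero hH hp hb_sum
  apply mul_left_cancel₀ hbq
  linear_combination n j * hb_sum - hb_bal

/-- If `G` is a 2-transitive subgroup of the symmetric group on `Fin m` (`m ≥ 2`),
`ε` a primitive `m`-th root of unity, and `n` is balanced with respect to `G`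
(`∑ i, n (σ i) * ε ^ (i+1) = 0` for all `σ ∈ G`), then every `n j` equals `(∑ k, n k) / m`;
in particular if `∑ k, n k = 0` then `n ≡ 0`. -/
theorem stmt_0 (m : ℕ) (hm : 2 ≤ m) (G : Subgroup (Equiv.Perm (Fin m)))
    (h2t : ∀ i j k l : Fin m, i ≠ j → k ≠ l → ∃ σ ∈ G, σ i = k ∧ σ j = l)
    (ε : ℂ) (hε : IsPrimitiveRoot ε m) (n : Fin m → ℂ)
    (hbal : ∀ σ ∈ G, ∑ i : Fin m, n (σ i) * ε ^ ((i : ℕ) + 1) = 0) :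
    (∀ j : Fin m, n j = (∑ k : Fin m, n k) / m) ∧
      ((∑ k : Fin m, n k) = 0 → ∀ j : Fin m, n j = 0) := by
  have : Nontrivial (Fin m) := Fin.nontrivial_iff_two_le.2 hm
  have hm0 : (m : ℂ) ≠ 0 := by exact_mod_cast (by omega : m ≠ 0)
  have ha : ∑ i : Fin m, ε ^ ((i : ℕ) + 1) = 0 := by
    simp only [pow_succ]
    rw [← Finset.sum_mul, Fin.sum_univ_eq_sum_range (fun i => ε ^ i),
      hε.geom_sum_eq_zero (by omega), zero_mul]
  have key (j : Fin m) : n j = (∑ k : Fin m, n k) / m := by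
    rw [eq_div_iff hm0, mul_comm]
    simpa using card_mul_eq_sum_of_two_transitive G h2t (fun i => ε ^ ((i : ℕ) + 1)) n ha
      ⟨0, by omega⟩ (pow_ne_zero _ (hε.ne_zero (by omega))) hbal j
  exact ⟨key, fun h j => by rw [key j, h, zero_div]⟩
end

section
/- Let f ∈ ℂ[X] be a monic polynomial of degree m ≥ 1 and let 0 ≤ k ≤ m−1. Then for every t ∈ ℂ, the k-th power sum of the roots of f − t in ℂ, counted with multiplicity, equals the k-th power sum of the roots of f: ∑_{z ∈ roots(f−t)} z^k = ∑_{z ∈ roots(f)} z^k. (In particular, the power sums s_0, …, s_{m−1} of the roots of f(X) − t are independent of t.) -/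
open Polynomial

/-- **Newton's identities** for the power sums of a multiset. -/
theorem Multiset.sum_map_pow_eq_mul_esymm_sub_sum {R : Type*} [CommRing R] (s : Multiset R)
    {k : ℕ} (hk : 0 < k) :
    (s.map (fun z => z ^ k)).sum = (-1) ^ (k + 1) * k * s.esymm k -
      ∑ a ∈ Finset.HasAntidiagonal.antidiagonal k with a.1 ∈ Set.Ioo 0 k,
        (-1) ^ a.1 * s.esymm a.1 * (s.map (fun z => z ^ a.2)).sum := by
  classical
  have hpsum (n : ℕ) : MvPolynomial.aeval (fun x : s => x.1) (MvPolynomial.psum s R n) =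
      (s.map (fun z => z ^ n)).sum := by
    rw [MvPolynomial.psum, map_sum]
    simp only [map_pow, MvPolynomial.aeval_X]
    conv_rhs => rw [← Multiset.map_univ_coe s, Multiset.map_map]
    rfl
  have hesymm (n : ℕ) : MvPolynomial.aeval (fun x : s => x.1) (MvPolynomial.esymm s R n) =
      s.esymm n := by
    rw [MvPolynomial.aeval_esymm_eq_multiset_esymm, Multiset.map_univ_coe]
  simpa only [map_sub, map_sum, map_mul, map_pow, map_neg, map_one, map_natCast, hpsum, hesymm]
    using congrArg (MvPolynomial.aeval (fun x : s => x.1))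
      (MvPolynomial.psum_eq_mul_esymm_sub_sum s R k hk)

/-- The power sums of degree at most `n` of a multiset are determined by its cardinality and its
elementary symmetric functions of degree at most `n`. -/
theorem Multiset.sum_map_pow_eq_of_esymm_eq {R : Type*} [CommRing R] {s t : Multiset R}
    (hcard : s.card = t.card) {n : ℕ} (h : ∀ i ≤ n, s.esymm i = t.esymm i) {k : ℕ} (hk : k ≤ n) :
    (s.map (fun z => z ^ k)).sum = (t.map (fun z => z ^ k)).sum := by
  induction k using Nat.strong_induction_on with
  | _ k ih =>
    rcases k.eq_zero_or_pos with rfl | hpos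
    · simp [hcard]
    · rw [s.sum_map_pow_eq_mul_esymm_sub_sum hpos, t.sum_map_pow_eq_mul_esymm_sub_sum hpos, h k hk]
      congr 1
      refine Finset.sum_congr rfl fun a ha => ?_
      simp only [Finset.mem_filter, Finset.HasAntidiagonal.mem_antidiagonal, Set.mem_Ioo] at ha
      rw [h a.1 (by lia), ih a.2 (by lia) (by lia)]

/-- The elementary symmetric functions of the roots of a split monic polynomial are its
coefficients up to sign. -/
theorem Polynomial.Monic.esymm_roots_eq_coeff {F : Type*} [Field F] {p : F[X]} (hp : p.Monic)
    (hsplit : p.Splits) {i : ℕ} (hi : i ≤ p.natDegree) :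
    p.roots.esymm i = (-1) ^ i * p.coeff (p.natDegree - i) := by
  rw [coeff_eq_esymm_roots_of_splits hsplit (Nat.sub_le _ _), hp.leadingCoeff,
    Nat.sub_sub_self hi, one_mul, ← mul_assoc, ← mul_pow]
  simp

/-- For a monic `f ∈ ℂ[X]` of degree `m ≥ 1` and `0 ≤ k ≤ m - 1`, the `k`-th power
sum of the roots (with multiplicity) of `f - t` equals the `k`-th power sum of the roots of `f`,
for every `t ∈ ℂ`. -/
theorem stmt_1 (m : ℕ) (hm : 1 ≤ m) (f : Polynomial ℂ) (hf : f.Monic)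
    (hdeg : f.natDegree = m) (k : ℕ) (hk : k ≤ m - 1) (t : ℂ) :
    (((f - Polynomial.C t).roots).map (fun z => z ^ k)).sum
      = ((f.roots).map (fun z => z ^ k)).sum := by
  have hsplit (p : ℂ[X]) : p.Splits := IsAlgClosed.splits p
  have hdeg' : (f - C t).natDegree = f.natDegree := natDegree_sub_C
  have hmonic : (f - C t).Monic := by
    rw [Monic, leadingCoeff, hdeg', coeff_sub, coeff_C_of_ne_zero (by lia), sub_zero]
    exact hf
  refine Multiset.sum_map_pow_eq_of_esymm_eq ?_ (fun i hi => ?_) hk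
  · rw [← (hsplit _).natDegree_eq_card_roots, ← (hsplit _).natDegree_eq_card_roots, hdeg']
  · rw [hmonic.esymm_roots_eq_coeff (hsplit _) (by lia), hf.esymm_roots_eq_coeff (hsplit _) (by lia),
      hdeg', coeff_sub, coeff_C_of_ne_zero (by lia), sub_zero]
end

section
/- Let m ≥ 1, let ζ = e^{2πi/m}, let n_0,…,n_{m−1} ∈ ℤ, and let P(X) = ∑_{j=0}^{m−1} n_j X^j be the associated characteristic polynomial. Let q_0,…,q_{m−1} ∈ ℂ[X] and set g(X) = ∑_{l=0}^{m−1} q_l(X^m) · X^l. Then ∑_{j=0}^{m−1} n_j g(ζ^j w) = 0 for every w ∈ ℂ if and only if for every l ∈ {0,…,m−1} with q_l ≠ 0 one has P(ζ^l) = 0, which in turn is equivalent to the cyclotomic polynomial Φ_{m/gcd(m,l)} dividing P in ℚ[X]. -/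
open Polynomial Real

theorem IsPrimitiveRoot.pow_div_gcd {M : Type*} [CommMonoid M] {ζ : M} {m : ℕ}
    (h : IsPrimitiveRoot ζ m) (hm : 0 < m) (l : ℕ) :
    IsPrimitiveRoot (ζ ^ l) (m / Nat.gcd m l) := by
  have hfin : IsOfFinOrder ζ := isOfFinOrder_iff_pow_eq_one.mpr ⟨m, hm, h.pow_eq_one⟩
  have horder := hfin.orderOf_pow ζ l
  rw [← h.eq_orderOf] at horder
  exact horder ▸ IsPrimitiveRoot.orderOf (ζ ^ l)

theorem Polynomial.coeff_comp_X_pow_mul_X_pow {R : Type*} [CommSemiring R] {m l i : ℕ}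
    (hl : l < m) (hi : i < m) (q : Polynomial R) (k : ℕ) :
    (q.comp (X ^ m) * X ^ l).coeff (m * k + i) = if l = i then q.coeff k else 0 := by
  have hm : 0 < m := by lia
  rw [← expand_eq_comp_X_pow, coeff_mul_X_pow', coeff_expand hm]
  split_ifs with hle hdvd heq heq heq
  · subst heq
    rw [Nat.add_sub_cancel, Nat.mul_div_cancel_left _ hm]
  · have hmod := (Nat.modEq_iff_dvd' hle).mpr hdvd
    have hli : l = i := by
      simpa [Nat.ModEq, Nat.mod_eq_of_lt, hl, hi] using hmod
    exact absurd hli heq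
  · subst heq
    exact absurd (by simp) hdvd
  · rfl
  · lia
  · rfl

/-- The summands of an expansion `∑ l < m, q l (X ^ m) * X ^ l` are unique. -/
theorem Polynomial.sum_comp_X_pow_mul_X_pow_eq_zero_iff {R : Type*} [CommSemiring R] {m : ℕ}
    (q : ℕ → Polynomial R) :
    ∑ l ∈ Finset.range m, (q l).comp (X ^ m) * X ^ l = 0 ↔ ∀ l < m, q l = 0 := by
  refine ⟨fun h i hi => ?_, fun h => Finset.sum_eq_zero fun l hl => ?_⟩
  · ext k
    have hk := congrArg (fun p => p.coeff (m * k + i)) h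
    simp only [finsetSum_coeff, coeff_zero] at hk
    rw [Finset.sum_congr rfl fun l hl =>
      coeff_comp_X_pow_mul_X_pow (Finset.mem_range.mp hl) hi (q l) k] at hk
    simpa [hi] using hk
  · simp [h l (Finset.mem_range.mp hl)]

/-- Let `ζ = e^{2πi/m}`, `P(X) = ∑_{j<m} n_j X^j` with `n_j ∈ ℤ`, and
`g(X) = ∑_{l<m} q_l(X^m) X^l`.  Then `∑_{j<m} n_j g(ζ^j w) = 0` for all `w` iff
`P(ζ^l) = 0` whenever `q_l ≠ 0` (`l < m`); moreover for each `l < m`, `P(ζ^l) = 0` iff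
the cyclotomic polynomial `Φ_{m / gcd(m,l)}` divides `P` in `ℚ[X]`. -/
theorem stmt_3 (m : ℕ) (hm : 1 ≤ m) (ζ : ℂ)
    (hζ : ζ = Complex.exp (2 * Real.pi * Complex.I / m))
    (n : ℕ → ℤ) (P : Polynomial ℂ)
    (hP : P = ∑ j ∈ Finset.range m, Polynomial.C ((n j : ℂ)) * Polynomial.X ^ j)
    (q : ℕ → Polynomial ℂ) (g : Polynomial ℂ)
    (hg : g = ∑ l ∈ Finset.range m, (q l).comp (Polynomial.X ^ m) * Polynomial.X ^ l) :
    ((∀ w : ℂ, ∑ j ∈ Finset.range m, (n j : ℂ) * g.eval (ζ ^ j * w) = 0) ↔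
      (∀ l < m, q l ≠ 0 → P.eval (ζ ^ l) = 0)) ∧
    (∀ l < m, (P.eval (ζ ^ l) = 0 ↔
      Polynomial.cyclotomic (m / Nat.gcd m l) ℚ ∣
        ∑ j ∈ Finset.range m, Polynomial.C ((n j : ℚ)) * Polynomial.X ^ j)) := by
  have hroot : IsPrimitiveRoot ζ m := hζ ▸ Complex.isPrimitiveRoot_exp m (by lia)
  refine ⟨?_, fun l _ => ?_⟩
  · have hsum : ∀ w : ℂ, ∑ j ∈ Finset.range m, (n j : ℂ) * g.eval (ζ ^ j * w) =
        (∑ l ∈ Finset.range m, (C (P.eval (ζ ^ l)) * q l).comp (X ^ m) * X ^ l).eval w := by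
      intro w
      simp only [hg, hP, eval_finsetSum, eval_mul, eval_comp, eval_pow, eval_X, eval_C,
        Finset.mul_sum, Finset.sum_mul]
      rw [Finset.sum_comm]
      refine Finset.sum_congr rfl fun l _ => Finset.sum_congr rfl fun j _ => ?_
      have hpow : (ζ ^ j * w) ^ m = w ^ m := by
        rw [mul_pow, pow_right_comm, hroot.pow_eq_one, one_pow, one_mul]
      rw [hpow, mul_pow, pow_right_comm]
      ring
    have hzero : ∀ p : ℂ[X], (∀ w, p.eval w = 0) ↔ p = 0 := fun p =>
      ⟨zero_of_eval_zero p, fun h => by simp [h]⟩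
    simp only [hsum]
    rw [hzero, sum_comp_X_pow_mul_X_pow_eq_zero_iff]
    refine forall₂_congr fun l _ => ?_
    rw [mul_eq_zero, C_eq_zero, or_comm, or_iff_not_imp_left]
  · have hl := hroot.pow_div_gcd hm l
    have hpos : 0 < m / Nat.gcd m l :=
      Nat.div_pos (Nat.gcd_le_left l hm) (Nat.gcd_pos_of_pos_left l hm)
    rw [cyclotomic_eq_minpoly_rat hl hpos, minpoly.dvd_iff, hP]
    simp [eval_finsetSum]
end

section
/- Let m ≥ 1, let j ≥ 0 be an integer, let n_0,…,n_{m−1} ∈ ℝ, let P(X) = ∑_{k=0}^{m−1} n_k X^k, let ε = e^{2πi/m}, and let T_j denote the j-th Chebyshev polynomial of the first kind (so T_j(cos θ) = cos(jθ) for all real θ). Then for every ξ ∈ ℝ: ∑_{k=0}^{m−1} n_k T_j(cos((ξ + 2kπ)/m)) = (1/2) e^{ijξ/m} P(ε^j) + (1/2) e^{−ijξ/m} P(ε^{−j}), and since the n_k are real this equals Re( e^{ijξ/m} P(ε^j) ). -/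
open Polynomial Real

/-- Multiplying the value of `∑ n_k X^k` at `e^{2πis/m}` by `e^{isξ/m}` shifts the phases. -/
theorem exp_mul_eval_exp_zpow (m : ℕ) (s : ℤ) (n : ℕ → ℝ) (ξ : ℝ) :
    Complex.exp (Complex.I * s * ξ / m) *
        (∑ k ∈ Finset.range m, Polynomial.C ((n k : ℂ)) * Polynomial.X ^ k).eval
          (Complex.exp (2 * Real.pi * Complex.I / m) ^ s)
      = ∑ k ∈ Finset.range m,
          (n k : ℂ) * Complex.exp (((s * ((ξ + 2 * k * Real.pi) / m) : ℝ) : ℂ) * Complex.I) := by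
  simp only [Polynomial.eval_finsetSum, Polynomial.eval_mul, Polynomial.eval_C,
    Polynomial.eval_pow, Polynomial.eval_X, Finset.mul_sum]
  refine Finset.sum_congr rfl fun k _ => ?_
  rw [← Complex.exp_int_mul, ← Complex.exp_nat_mul, mul_left_comm, ← Complex.exp_add]
  congr 2
  push_cast
  ring

/-- For real `n_0,…,n_{m-1}`, `P(X) = ∑_{k<m} n_k X^k`, `ε = e^{2πi/m}`,
`T_j` the `j`-th Chebyshev polynomial of the first kind, and every `ξ ∈ ℝ`:
`∑_{k<m} n_k T_j(cos((ξ+2kπ)/m)) = ½ e^{ijξ/m} P(ε^j) + ½ e^{-ijξ/m} P(ε^{-j})`,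
and this equals `Re(e^{ijξ/m} P(ε^j))`. -/
theorem stmt_4 (m : ℕ) (hm : 1 ≤ m) (j : ℕ) (n : ℕ → ℝ) (P : Polynomial ℂ)
    (hP : P = ∑ k ∈ Finset.range m, Polynomial.C ((n k : ℂ)) * Polynomial.X ^ k)
    (ε : ℂ) (hε : ε = Complex.exp (2 * Real.pi * Complex.I / m)) (ξ : ℝ) :
    ((↑(∑ k ∈ Finset.range m,
        n k * (Polynomial.Chebyshev.T ℝ (j : ℤ)).eval
          (Real.cos ((ξ + 2 * k * Real.pi) / m))) : ℂ)
      = (1 / 2) * Complex.exp (Complex.I * j * ξ / m) * P.eval (ε ^ j)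
        + (1 / 2) * Complex.exp (-(Complex.I * j * ξ / m)) * P.eval (ε ^ (-(j : ℤ)))) ∧
    (∑ k ∈ Finset.range m,
        n k * (Polynomial.Chebyshev.T ℝ (j : ℤ)).eval
          (Real.cos ((ξ + 2 * k * Real.pi) / m))
      = (Complex.exp (Complex.I * j * ξ / m) * P.eval (ε ^ j)).re) := by
  subst hP hε
  have hpos := exp_mul_eval_exp_zpow m j n ξ
  have hneg := exp_mul_eval_exp_zpow m (-j) n ξ
  rw [zpow_natCast, Int.cast_natCast] at hpos
  rw [show Complex.I * ((-(j : ℤ) : ℤ) : ℂ) * ξ / m = -(Complex.I * j * ξ / m) by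
    push_cast; ring] at hneg
  constructor
  · rw [mul_assoc (1 / 2), mul_assoc (1 / 2), hpos, hneg, ← mul_add, ← Finset.sum_add_distrib,
      Finset.mul_sum, Complex.ofReal_sum]
    refine Finset.sum_congr rfl fun k _ => ?_
    rw [Polynomial.Chebyshev.T_real_cos, Complex.ofReal_mul, Complex.ofReal_cos, Complex.cos]
    push_cast
    ring_nf
  · rw [hpos, Complex.re_sum]
    refine Finset.sum_congr rfl fun k _ => ?_
    rw [Polynomial.Chebyshev.T_real_cos, Complex.re_ofReal_mul, Complex.exp_ofReal_mul_I_re]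
end

section
/- Let m ≥ 1, let n_0,…,n_{m−1} ∈ ℝ, let P(X) = ∑_{k=0}^{m−1} n_k X^k, and let ε = e^{2πi/m}. Let q_0,…,q_{m−1} ∈ ℝ[X] and set g(X) = ∑_{l=0}^{m−1} q_l(T_m(X)) · T_l(X), where T_j is the j-th Chebyshev polynomial of the first kind. Then ∑_{k=0}^{m−1} n_k g(cos((ξ + 2kπ)/m)) = 0 for every ξ ∈ ℝ if and only if for every l ∈ {0,…,m−1} with q_l ≠ 0 one has P(ε^l) = 0. -/
open Polynomial Real

open scoped ComplexConjugate

/-- Sampling `∑ q_l(T_m) T_l` along the preimages of `cos ξ` under `T_m`. -/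
lemma sum_mul_eval_cos_eq (m : ℕ) (hm : m ≠ 0) (n : ℕ → ℝ) (q : ℕ → Polynomial ℝ) (ξ : ℝ) :
    ∑ k ∈ Finset.range m, n k * (∑ l ∈ Finset.range m,
        (q l).comp (Chebyshev.T ℝ (m : ℤ)) * Chebyshev.T ℝ (l : ℤ)).eval
          (Real.cos ((ξ + 2 * k * π) / m)) =
      ∑ l ∈ Finset.range m, (q l).eval (Real.cos ξ) *
        (Complex.exp (l * (ξ / m) * Complex.I) *
          (∑ k ∈ Finset.range m, Polynomial.C (n k : ℂ) * X ^ k).eval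
            (Complex.exp (2 * π * Complex.I / m) ^ l)).re := by
  have hm' : (m : ℝ) ≠ 0 := Nat.cast_ne_zero.mpr hm
  have hmul (k : ℕ) : (m : ℝ) * ((ξ + 2 * k * π) / m) = ξ + k * (2 * π) := by
    field_simp
  have hexp (k l : ℕ) : Complex.exp (l * (ξ / m) * Complex.I) *
      (Complex.exp (2 * π * Complex.I / m) ^ l) ^ k =
        Complex.exp ((l * ((ξ + 2 * k * π) / m) : ℝ) * Complex.I) := by
    rw [← pow_mul, ← Complex.exp_nat_mul, ← Complex.exp_add]
    congr 1
    push_cast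
    field_simp
  simp only [eval_finsetSum, eval_mul, eval_comp, Chebyshev.T_real_cos, Int.cast_natCast, hmul,
    Real.cos_add_nat_mul_two_pi, eval_C, eval_pow, eval_X, Finset.mul_sum, Complex.re_sum]
  rw [Finset.sum_comm]
  refine Finset.sum_congr rfl fun l _ => Finset.sum_congr rfl fun k _ => ?_
  rw [mul_left_comm (Complex.exp _), hexp, Complex.re_ofReal_mul, Complex.exp_ofReal_mul_I_re]
  ring

/-- If the real part of the discrete Fourier transform of `A` vanishes, then `A` is
anti-Hermitian-symmetric. -/
lemma add_conj_eq_zero_of_forall_re_sum_eq_zero {M : ℕ} {ε : ℂ} (hε : IsPrimitiveRoot ε (M + 1))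
    (A : ℕ → ℂ)
    (hA : ∀ j : ℕ, (∑ l ∈ Finset.range (M + 1), A l * (ε ^ l) ^ j).re = 0) :
    A 0 + conj (A 0) = 0 ∧ ∀ l < M, A (l + 1) + conj (A (M - l)) = 0 := by
  have hconj : conj ε = ε⁻¹ :=
    (Complex.inv_eq_conj (hε.norm'_eq_one M.succ_ne_zero)).symm
  let B : ℕ → ℂ := fun l => Nat.casesOn l (A 0 + conj (A 0)) fun l => A (l + 1) + conj (A (M - l))
  have hB : (fun i : Fin (M + 1) => B i) = 0 := by
    refine Matrix.eq_zero_of_forall_pow_sum_mul_pow_eq_zero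
      (f := fun i : Fin (M + 1) => ε ^ (i : ℕ)) ?_ fun j => ?_
    · intro a b hab
      exact Fin.ext (hε.pow_inj a.2 b.2 hab)
    · have h := hA j
      rw [← Complex.ofReal_inj, Complex.re_eq_add_conj, map_sum, Complex.ofReal_zero,
        div_eq_zero_iff, or_iff_left two_ne_zero] at h
      rw [Fin.sum_univ_eq_sum_range (fun l => B l * (ε ^ l) ^ (j : ℕ)), ← h,
        Finset.sum_range_succ', Finset.sum_range_succ', Finset.sum_range_succ',
        ← Finset.sum_range_reflect (fun l => conj (A (l + 1) * (ε ^ (l + 1)) ^ (j : ℕ)))]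
      have hsum : ∀ l ∈ Finset.range M, B (l + 1) * (ε ^ (l + 1)) ^ (j : ℕ) =
          A (l + 1) * (ε ^ (l + 1)) ^ (j : ℕ) +
            conj (A (M - 1 - l + 1) * (ε ^ (M - 1 - l + 1)) ^ (j : ℕ)) := by
        intro l hl
        have hl' := Finset.mem_range.mp hl
        have hpow : (ε⁻¹) ^ (M - l) = ε ^ (l + 1) := by
          rw [inv_pow]
          refine inv_eq_of_mul_eq_one_right ?_
          rw [← pow_add, show M - l + (l + 1) = M + 1 by omega, hε.pow_eq_one]
        rw [show M - 1 - l + 1 = M - l by omega, map_mul, map_pow, map_pow, hconj, hpow, ← add_mul]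
      rw [Finset.sum_congr rfl hsum, Finset.sum_add_distrib]
      have hB0 : B 0 = A 0 + conj (A 0) := rfl
      simp only [hB0, pow_zero, one_pow, mul_one]
      ring
  refine ⟨congrFun hB 0, fun l hl => congrFun hB ⟨l + 1, by omega⟩⟩

lemma eq_zero_of_forall_sin_mul_eval_cos_eq_zero {p : Polynomial ℝ}
    (h : ∀ ξ : ℝ, Real.sin ξ * p.eval (Real.cos ξ) = 0) : p = 0 := by
  refine Polynomial.eq_zero_of_infinite_isRoot p
    ((Set.Ioo_infinite (show (-1 : ℝ) < 1 by norm_num)).mono fun x hx => ?_)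
  have hx' := h (Real.arccos x)
  rw [Real.cos_arccos hx.1.le hx.2.le, Real.sin_arccos] at hx'
  refine (mul_eq_zero.mp hx').resolve_left (Real.sqrt_ne_zero'.mpr ?_)
  nlinarith [hx.1, hx.2]

/-- `1` and `exp (-iξ)` are linearly independent over the polynomials in `cos ξ`. -/
lemma eq_zero_of_forall_eval_cos_add_exp_mul_eq_zero {p r : Polynomial ℝ}
    (h : ∀ ξ : ℝ, ((p.eval (Real.cos ξ) : ℝ) : ℂ) +
      Complex.exp (-(ξ : ℂ) * Complex.I) * ((r.eval (Real.cos ξ) : ℝ) : ℂ) = 0) : p = 0 := by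
  have hr : r = 0 := by
    refine eq_zero_of_forall_sin_mul_eval_cos_eq_zero fun ξ => ?_
    have him := congrArg Complex.im (h ξ)
    rw [← Complex.ofReal_neg, Complex.add_im, Complex.ofReal_im, mul_comm, Complex.im_ofReal_mul,
      Complex.exp_ofReal_mul_I_im, Real.sin_neg, Complex.zero_im] at him
    linarith
  refine eq_zero_of_forall_sin_mul_eval_cos_eq_zero fun ξ => ?_
  have hp : ((p.eval (Real.cos ξ) : ℝ) : ℂ) = 0 := by simpa [hr] using h ξ
  rw [Complex.ofReal_eq_zero.mp hp, mul_zero]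

/-- Values at conjugate roots of unity of a polynomial with real coefficients are conjugate. -/
lemma conj_eval_pow_sub {m l : ℕ} {ε : ℂ} (hm : m ≠ 0) (hε : IsPrimitiveRoot ε m) (hl : l ≤ m)
    (n : ℕ → ℝ) :
    conj ((∑ k ∈ Finset.range m, Polynomial.C (n k : ℂ) * X ^ k).eval (ε ^ (m - l))) =
      (∑ k ∈ Finset.range m, Polynomial.C (n k : ℂ) * X ^ k).eval (ε ^ l) := by
  have hpow : conj (ε ^ (m - l)) = ε ^ l := by
    rw [map_pow, ← Complex.inv_eq_conj (hε.norm'_eq_one hm), inv_pow]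
    refine inv_eq_of_mul_eq_one_right ?_
    rw [← pow_add, Nat.sub_add_cancel hl, hε.pow_eq_one]
  simp only [eval_finsetSum, eval_mul, eval_C, eval_pow, eval_X, map_sum, map_mul,
    Complex.conj_ofReal]
  exact Finset.sum_congr rfl fun k _ => by rw [map_pow, hpow]

/-- For real `n_0,…,n_{m-1}`, `P(X) = ∑_{k<m} n_k X^k`, `ε = e^{2πi/m}`,
and `g(X) = ∑_{l<m} q_l(T_m(X)) T_l(X)` with `q_l ∈ ℝ[X]`:
`∑_{k<m} n_k g(cos((ξ+2kπ)/m)) = 0` for every `ξ ∈ ℝ` iff `P(ε^l) = 0` for every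
`l < m` with `q_l ≠ 0`. -/
theorem stmt_5 (m : ℕ) (hm : 1 ≤ m) (n : ℕ → ℝ) (P : Polynomial ℂ)
    (hP : P = ∑ k ∈ Finset.range m, Polynomial.C ((n k : ℂ)) * Polynomial.X ^ k)
    (ε : ℂ) (hε : ε = Complex.exp (2 * Real.pi * Complex.I / m))
    (q : ℕ → Polynomial ℝ) (g : Polynomial ℝ)
    (hg : g = ∑ l ∈ Finset.range m,
        (q l).comp (Polynomial.Chebyshev.T ℝ (m : ℤ)) * Polynomial.Chebyshev.T ℝ (l : ℤ)) :
    (∀ ξ : ℝ, ∑ k ∈ Finset.range m,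
        n k * g.eval (Real.cos ((ξ + 2 * k * Real.pi) / m)) = 0) ↔
      (∀ l < m, q l ≠ 0 → P.eval (ε ^ l) = 0) := by
  subst hP hg
  have hm0 : m ≠ 0 := by omega
  have hprim : IsPrimitiveRoot ε m := hε ▸ Complex.isPrimitiveRoot_exp m hm0
  set P : Polynomial ℂ := ∑ k ∈ Finset.range m, Polynomial.C ((n k : ℂ)) * Polynomial.X ^ k with hP
  simp only [sum_mul_eval_cos_eq m hm0, ← hε, ← hP]
  refine ⟨fun h => ?_, fun h ξ => Finset.sum_eq_zero fun l hl => ?_⟩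
  swap
  · by_cases hq : q l = 0
    · simp [hq]
    · simp [h l (Finset.mem_range.mp hl) hq]
  obtain ⟨M, rfl⟩ : ∃ M, m = M + 1 := ⟨m - 1, by omega⟩
  set E : ℝ → ℕ → ℂ := fun ξ l => Complex.exp (l * (ξ / (M + 1 : ℕ)) * Complex.I) with hE
  have hshift (ξ : ℝ) (j l : ℕ) : E (ξ + j * (2 * π)) l = E ξ l * (ε ^ l) ^ j := by
    rw [hE, hε]
    simp only
    rw [← pow_mul, ← Complex.exp_nat_mul, ← Complex.exp_add]
    congr 1
    push_cast
    field_simp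
  have hsymm (ξ : ℝ) := add_conj_eq_zero_of_forall_re_sum_eq_zero hprim
    (fun l => (((q l).eval (Real.cos ξ) : ℝ) : ℂ) * (E ξ l * P.eval (ε ^ l))) fun j => by
      rw [← h (ξ + j * (2 * π)), Complex.re_sum]
      refine Finset.sum_congr rfl fun l _ => ?_
      rw [Real.cos_add_nat_mul_two_pi, ← Complex.re_ofReal_mul]
      change _ = (_ * (E (ξ + j * (2 * π)) l * _)).re
      rw [hshift]
      ring_nf
  intro l hl hq
  by_contra hPl
  refine hq ?_
  rcases l with _ | l
  · refine eq_zero_of_forall_sin_mul_eval_cos_eq_zero fun ξ => ?_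
    have hreal : conj (P.eval (ε ^ 0)) = P.eval (ε ^ 0) := by
      have := conj_eval_pow_sub hm0 hprim (Nat.zero_le _) n
      rwa [Nat.sub_zero, hprim.pow_eq_one, ← pow_zero ε] at this
    have h0 := (hsymm ξ).1
    have hE0 : E ξ 0 = 1 := by simp [hE]
    simp only [hE0, one_mul, map_mul, Complex.conj_ofReal, hreal, ← two_mul] at h0
    have := (mul_eq_zero.mp ((mul_eq_zero.mp h0).resolve_left two_ne_zero)).resolve_right hPl
    rw [Complex.ofReal_eq_zero.mp this, mul_zero]
  · have hlM : l < M := by omega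
    refine eq_zero_of_forall_eval_cos_add_exp_mul_eq_zero (r := q (M - l)) fun ξ => ?_
    have hl0 := (hsymm ξ).2 l hlM
    have hconj : conj (P.eval (ε ^ (M - l))) = P.eval (ε ^ (l + 1)) := by
      rw [← conj_eval_pow_sub hm0 hprim (show l + 1 ≤ M + 1 by omega) n, Nat.add_sub_add_right]
    have hEconj : conj (E ξ (M - l)) = E ξ (l + 1) * Complex.exp (-(ξ : ℂ) * Complex.I) := by
      simp only [hE]
      rw [← Complex.exp_conj, ← Complex.exp_add]
      congr 1
      have hM : (M : ℂ) + 1 ≠ 0 := by exact_mod_cast M.succ_ne_zero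
      simp only [map_mul, map_div₀, map_natCast, Complex.conj_ofReal, Complex.conj_I]
      push_cast [Nat.cast_sub hlM.le]
      field_simp
      ring
    simp only [map_mul, Complex.conj_ofReal, hconj, hEconj] at hl0
    refine (mul_eq_zero.mp (?_ : E ξ (l + 1) * P.eval (ε ^ (l + 1)) * _ = 0)).resolve_left
      (mul_ne_zero (Complex.exp_ne_zero _) hPl)
    rw [← hl0]
    ring
end

section
/- Let f ∈ ℂ[X] be monic nonconstant of degree m, let K = ℂ(t), let L be a splitting field of f(X) − t over K with roots z_1,…,z_m ∈ L, and let n_1,…,n_m ∈ ℂ. Let p ∈ ℂ[t] with p ≠ 0. Then there exists g ∈ ℂ[X] with ∑_{i=1}^m n_i g(z_i) = p(t) in L if and only if ∑_{i=1}^m n_i ≠ 0 (i.e., the chain is not a 0-cycle). Moreover, if s := ∑_{i=1}^m n_i ≠ 0, then for any g ∈ ℂ[X]: ∑_{i=1}^m n_i g(z_i) = p(t) in L if and only if ∑_{i=1}^m n_i g̃(z_i) = 0 in L, where g̃ = g − (1/s)·(p ∘ f). -/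
open Polynomial

theorem irreducible_map_C_sub_C_X {F : Type*} [Field F] (f : F[X]) :
    Irreducible (f.map (C : F →+* F[X]) - C X) := by
  rw [← MulEquiv.irreducible_iff (Polynomial.Bivariate.swap (R := F)), map_sub,
    Polynomial.Bivariate.swap_map_C, Polynomial.Bivariate.swap_X, ← neg_sub]
  exact (Associated.neg_left (Associated.refl _)).irreducible_iff.mpr (irreducible_X_sub_C f)

theorem monic_map_C_sub_C {R S : Type*} [CommRing R] [CommRing S] [Nontrivial S] {f : R[X]}
    (hf : f.Monic) (hdeg : 1 ≤ f.natDegree) (φ : R →+* S) (a : S) :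
    (f.map φ - C a).Monic := by
  refine (hf.map φ).sub_of_left (degree_C_le.trans_lt ?_)
  rw [hf.degree_map]
  exact natDegree_pos_iff_degree_pos.mp hdeg

theorem irreducible_map_sub_C_ratFuncX {F : Type*} [Field F] {f : F[X]} (hf : f.Monic)
    (hdeg : 1 ≤ f.natDegree) :
    Irreducible (f.map (algebraMap F (RatFunc F)) - C RatFunc.X) := by
  have h := ((monic_map_C_sub_C hf hdeg C X).irreducible_iff_irreducible_map_fraction_map
    (K := RatFunc F)).mp (irreducible_map_C_sub_C_X f)
  rw [Polynomial.map_sub, Polynomial.map_map, map_C, RatFunc.algebraMap_X] at h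
  exact h

/-- Elements of a normal extension with the same minimal polynomial have polynomial expressions
of equal trace. -/
theorem trace_aeval_eq_of_minpoly_eq {K L : Type*} [Field K] [Field L] [Algebra K L] [Normal K L]
    {x y : L} (h : minpoly K x = minpoly K y) (q : K[X]) :
    Algebra.trace K L (aeval x q) = Algebra.trace K L (aeval y q) := by
  obtain ⟨σ, rfl⟩ := (Normal.minpoly_eq_iff_mem_orbit L).mp h
  rw [← Algebra.trace_eq_of_algEquiv σ (aeval y q), ← aeval_algHom_apply σ y q]
  rfl

/-- In the Galois framework for `f(X) - t` over `K = ℂ(t)` with splitting field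
`L` and roots `z_1, …, z_m`, for a chain `(n_1, …, n_m)` and `0 ≠ p ∈ ℂ[t]`:
there exists `g ∈ ℂ[X]` with `∑ nᵢ g(zᵢ) = p(t)` iff `∑ nᵢ ≠ 0`; and if `s = ∑ nᵢ ≠ 0`
then `∑ nᵢ g(zᵢ) = p(t)` iff `∑ nᵢ g̃(zᵢ) = 0` where `g̃ = g - s⁻¹ • (p ∘ f)`. -/
theorem stmt_6 (m : ℕ) (hm : 1 ≤ m) (f : Polynomial ℂ) (hf : f.Monic)
    (hdeg : f.natDegree = m)
    (L : Type) [Field L] [Algebra ℂ L] [Algebra (RatFunc ℂ) L]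
    [IsScalarTower ℂ (RatFunc ℂ) L]
    (hsplit : Polynomial.IsSplittingField (RatFunc ℂ) L
      (f.map (algebraMap ℂ (RatFunc ℂ)) - Polynomial.C RatFunc.X))
    (z : Fin m → L) (hzinj : Function.Injective z)
    (hzroot : ∀ i : Fin m,
      Polynomial.aeval (z i) f = algebraMap (RatFunc ℂ) L RatFunc.X)
    (n : Fin m → ℂ) (p : Polynomial ℂ) (hp : p ≠ 0) :
    ((∃ g : Polynomial ℂ,
        ∑ i : Fin m, algebraMap ℂ L (n i) * Polynomial.aeval (z i) g
          = Polynomial.aeval (algebraMap (RatFunc ℂ) L RatFunc.X) p) ↔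
      (∑ i : Fin m, n i) ≠ 0) ∧
    ((∑ i : Fin m, n i) ≠ 0 → ∀ g : Polynomial ℂ,
      ((∑ i : Fin m, algebraMap ℂ L (n i) * Polynomial.aeval (z i) g
          = Polynomial.aeval (algebraMap (RatFunc ℂ) L RatFunc.X) p) ↔
        ∑ i : Fin m, algebraMap ℂ L (n i) *
          Polynomial.aeval (z i)
            (g - Polynomial.C (∑ i : Fin m, n i)⁻¹ * (p.comp f)) = 0)) := by
  have hp0 : aeval (algebraMap (RatFunc ℂ) L RatFunc.X) p ≠ 0 := by
    rw [← RatFunc.algebraMap_X, aeval_algebraMap_apply, aeval_algebraMap_apply, aeval_X_left_apply]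
    simpa using hp
  have hcomp (i : Fin m) : aeval (z i) (p.comp f)
      = aeval (algebraMap (RatFunc ℂ) L RatFunc.X) p := by
    rw [aeval_comp, hzroot]
  have hshift (hs : ∑ i, n i ≠ 0) (g : ℂ[X]) :
      ∑ i, algebraMap ℂ L (n i) * aeval (z i) (g - C (∑ i, n i)⁻¹ * p.comp f)
        = ∑ i, algebraMap ℂ L (n i) * aeval (z i) g
          - aeval (algebraMap (RatFunc ℂ) L RatFunc.X) p := by
    simp only [map_sub, map_mul, hcomp, aeval_C, mul_sub, Finset.sum_sub_distrib]
    rw [← Finset.sum_mul, ← map_sum, ← mul_assoc, ← map_mul, mul_inv_cancel₀ hs, map_one, one_mul]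
  refine ⟨⟨?_, fun hs => ⟨C (∑ i, n i)⁻¹ * p.comp f, ?_⟩⟩, fun hs g => ?_⟩
  · rintro ⟨g, hg⟩ hs
    have hfin : FiniteDimensional (RatFunc ℂ) L := hsplit.finiteDimensional _ _
    have hnormal : Normal (RatFunc ℂ) L := .of_isSplittingField
      (f.map (algebraMap ℂ (RatFunc ℂ)) - C RatFunc.X)
    have hmin (i : Fin m) : minpoly (RatFunc ℂ) (z i)
        = f.map (algebraMap ℂ (RatFunc ℂ)) - C RatFunc.X :=
      (minpoly.eq_of_irreducible_of_monic
        (irreducible_map_sub_C_ratFuncX hf (hdeg ▸ hm)) (by rw [map_sub, aeval_map_algebraMap, hzroot, aeval_C, sub_self])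
        (monic_map_C_sub_C hf (hdeg ▸ hm) _ _)).symm
    let T := Algebra.trace (RatFunc ℂ) L
    have hT (i : Fin m) : T (aeval (z i) g) = T (aeval (z ⟨0, hm⟩) g) := by
      simpa only [aeval_map_algebraMap] using trace_aeval_eq_of_minpoly_eq
        ((hmin i).trans (hmin ⟨0, hm⟩).symm) (g.map (algebraMap ℂ (RatFunc ℂ)))
    have htr := congrArg T hg
    have hL : T (∑ i, algebraMap ℂ L (n i) * aeval (z i) g) = 0 := by
      simp_rw [map_sum, IsScalarTower.algebraMap_apply ℂ (RatFunc ℂ) L, ← Algebra.smul_def,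
        map_smul, hT]
      rw [← Finset.sum_smul, ← map_sum, hs, map_zero, zero_smul]
    rw [hL, aeval_algebraMap_apply, Algebra.trace_algebraMap, eq_comm, smul_eq_zero] at htr
    rcases htr with h | h
    · exact Module.finrank_pos.ne' h
    · exact hp0 (by rw [aeval_algebraMap_apply, h, map_zero])
  · rw [← sub_eq_zero, ← hshift hs, sub_self]
    simp
  · rw [hshift hs, sub_eq_zero]
end

section
/- Let f = f̃ ∘ h with f̃ ∈ ℂ[X] and h(X) = X^d or h = T_d the d-th Chebyshev polynomial, 1 < d < m = deg f, f monic. Work in the Galois framework: L is a splitting field of f(X) − t over K = ℂ(t), G = Gal(L/K), the m distinct roots z_1,…,z_m ∈ L are numbered so that some σ_∞ ∈ G satisfies σ_∞(z_i) = z_{i+1 (mod m)}; assume that under this numbering h(z_i) = h(z_j) holds exactly when i ≡ j (mod m/d), so the blocks of the imprimitivity system of h are B_l = {l, l + m/d, …, l + (d−1)·m/d}. Let C = (n_1,…,n_m) ∈ ℤ^m be a balanced 0-cycle of f, and assume the critical values of f̃ and h do not merge. Then: (a) every h-invariant part of C is balanced, i.e., for each l, ∑_{j=0}^{d−1} n_{l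 + j·m/d} · ε_d^j = 0, where ε_d is a primitive d-th root of unity; and (b) for g ∈ ℂ[X]: ∑_{j=1}^m n_j g(z_j) = 0 in L if and only if there exist g̃, u ∈ ℂ[X] with g = (1/(d−1))·(g̃ ∘ h) + u, ∑_{j=1}^m n_j g̃(h(z_j)) = 0 in L, and ∑_{j ∈ B_l} n_j u(z_j) = 0 in L for every block B_l. -/
open Polynomial

/-- The critical values of `f̃` and `h` do not merge in the composition `f = f̃ ∘ h`. -/
def CriticalValuesDoNotMerge (ftilde h : Polynomial ℂ) : Prop :=
  (¬ ∃ a b : ℂ, (Polynomial.derivative ftilde).eval (h.eval a) = 0 ∧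
      (Polynomial.derivative h).eval b = 0 ∧
      (ftilde.comp h).eval a = (ftilde.comp h).eval b) ∧
  (∀ b b' : ℂ, (Polynomial.derivative h).eval b = 0 →
      (Polynomial.derivative h).eval b' = 0 →
      ftilde.eval (h.eval b) = ftilde.eval (h.eval b') → h.eval b = h.eval b')

theorem algebraMap_ratFunc_algebraMap {L : Type} [Field L] [Algebra ℂ L]
    [Algebra (RatFunc ℂ) L] [IsScalarTower ℂ (RatFunc ℂ) L] (p : ℂ[X]) :
    algebraMap (RatFunc ℂ) L (algebraMap ℂ[X] (RatFunc ℂ) p) =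
      aeval (algebraMap (RatFunc ℂ) L RatFunc.X) p := by
  rw [aeval_algebraMap_apply, ← RatFunc.algebraMap_X, aeval_algebraMap_apply, aeval_X_left_apply]

theorem transcendental_of_aeval_eq_X {L : Type} [Field L] [Algebra ℂ L]
    [Algebra (RatFunc ℂ) L] [IsScalarTower ℂ (RatFunc ℂ) L] {x : L} {q : ℂ[X]}
    (hq : aeval x q = algebraMap (RatFunc ℂ) L RatFunc.X) : Transcendental ℂ x := by
  intro hx
  have h1 : IsAlgebraic ℂ (aeval x q) :=
    (IsIntegral.of_mem_of_fg _ hx.isIntegral.fg_adjoin_singleton _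
      (aeval_mem_adjoin_singleton ℂ x)).isAlgebraic
  rw [hq] at h1
  obtain ⟨p, hp0, hp⟩ := h1
  rw [← algebraMap_ratFunc_algebraMap, map_eq_zero_iff _ (algebraMap (RatFunc ℂ) L).injective] at hp
  exact hp0 ((map_eq_zero_iff _ (RatFunc.algebraMap_injective ℂ)).1 hp)

open scoped IntermediateField.algebraAdjoinAdjoin in
theorem exists_aeval_eq_of_forall_fixed {L : Type} [Field L] [Algebra ℂ L]
    [Algebra (RatFunc ℂ) L] [IsScalarTower ℂ (RatFunc ℂ) L] [FiniteDimensional (RatFunc ℂ) L]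
    [IsGalois (RatFunc ℂ) L] {x y : L} {q : ℂ[X]}
    (hq : aeval x q = algebraMap (RatFunc ℂ) L RatFunc.X)
    (hy : (aeval x : ℂ[X] →ₐ[ℂ] L).toRingHom.IsIntegralElem y)
    (hfix : ∀ σ : L ≃ₐ[RatFunc ℂ] L, σ x = x → σ y = y) : ∃ p : ℂ[X], aeval x p = y := by
  have hx := transcendental_of_aeval_eq_X hq
  let E := IntermediateField.adjoin ℂ {x}
  have hxE : x ∈ E := IntermediateField.mem_adjoin_simple_self ℂ x
  have haev : ∀ p : ℂ[X], aeval x p ∈ E := fun p =>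
    IntermediateField.aeval_coe E ⟨x, hxE⟩ p ▸ SetLike.coe_mem _
  have hK : ∀ k : RatFunc ℂ, algebraMap (RatFunc ℂ) L k ∈ E := fun k => by
    rw [← RatFunc.num_div_denom k, map_div₀, algebraMap_ratFunc_algebraMap,
      algebraMap_ratFunc_algebraMap, ← hq, ← aeval_comp, ← aeval_comp]
    exact div_mem (haev _) (haev _)
  let E' : IntermediateField (RatFunc ℂ) L := E.toSubfield.toIntermediateField hK
  have h1 : y ∈ IntermediateField.adjoin (RatFunc ℂ) {x} := by
    rw [← IsGalois.fixedField_fixingSubgroup (IntermediateField.adjoin (RatFunc ℂ) {x})]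
    rintro ⟨σ, hσ⟩
    exact hfix σ (hσ ⟨x, IntermediateField.mem_adjoin_simple_self _ x⟩)
  have h2 : IntermediateField.adjoin (RatFunc ℂ) {x} ≤ E' := by
    rw [IntermediateField.adjoin_le_iff]
    rintro _ rfl
    exact hxE
  have hyE : y ∈ E := h2 h1
  have hyA : IsIntegral (Algebra.adjoin ℂ {x}) y := by
    obtain ⟨p, hpm, hp⟩ := hy
    refine ⟨p.map (algEquivOfTranscendental ℂ x hx).toRingEquiv.toRingHom, hpm.map _, ?_⟩
    rw [eval₂_map, ← hp]
    congr 1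
    ext <;> simp
  have hic : IsIntegrallyClosed (Algebra.adjoin ℂ {x}) :=
    IsIntegrallyClosed.of_equiv (algEquivOfTranscendental ℂ x hx).toRingEquiv
  have h3 : IsIntegral (Algebra.adjoin ℂ {x}) (⟨y, hyE⟩ : E) :=
    (isIntegral_algebraMap_iff (B := L) (algebraMap E L).injective).1 hyA
  obtain ⟨⟨a, ha⟩, hay⟩ := (IsIntegrallyClosed.isIntegral_iff (K := E)).1 h3
  rw [Algebra.adjoin_singleton_eq_range_aeval] at ha
  obtain ⟨p, hp⟩ := ha
  refine ⟨p, ?_⟩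
  have := congrArg (algebraMap E L) hay
  exact hp.trans this

theorem exists_algHom_apply_eq {L : Type} [Field L] [Algebra ℂ L] (R : Subalgebra ℂ L)
    [Algebra.FiniteType ℂ R] (x : R) (hx : Transcendental ℂ (x : L))
    (hR : ∀ y ∈ R, (aeval (x : L) : ℂ[X] →ₐ[ℂ] L).toRingHom.IsIntegralElem y) (b : ℂ) :
    ∃ φ : R →ₐ[ℂ] ℂ, φ x = b := by
  let : Algebra ℂ[X] R := (aeval x : ℂ[X] →ₐ[ℂ] R).toAlgebra
  have halg : ∀ p, algebraMap ℂ[X] R p = aeval x p := fun _ => rfl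
  have hRint : Algebra.IsIntegral ℂ[X] R := by
    refine ⟨fun y => ?_⟩
    obtain ⟨p, hpm, hp⟩ := hR y y.2
    refine ⟨p, hpm, Subtype.ext ?_⟩
    change R.val.toRingHom _ = R.val.toRingHom 0
    rw [hom_eval₂, map_zero]
    refine Eq.trans ?_ hp
    simp only [AlgHom.toRingHom_eq_coe]
    congr 1
    ext <;> simp [halg]
  have hinj : Function.Injective (algebraMap ℂ[X] R) := by
    intro p q hpq
    refine (transcendental_iff_injective.1 hx) ?_
    rw [Subalgebra.aeval_coe, Subalgebra.aeval_coe]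
    exact congrArg _ hpq
  have hP : (RingHom.ker (evalRingHom b)).IsMaximal :=
    RingHom.ker_isMaximal_of_surjective _ fun c => ⟨C c, by simp⟩
  obtain ⟨Q, hQ, hQP⟩ := Ideal.exists_ideal_over_maximal_of_isIntegral (S := R)
    (RingHom.ker (evalRingHom b)) (by
      rw [(RingHom.injective_iff_ker_eq_bot _).1 hinj]
      exact bot_le)
  let := Ideal.Quotient.field Q
  have : Module.Finite ℂ (R ⧸ Q) := finite_of_finite_type_of_isJacobsonRing ℂ (R ⧸ Q)
  let e : ℂ ≃ₐ[ℂ] R ⧸ Q := AlgEquiv.ofBijective (Algebra.ofId ℂ (R ⧸ Q))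
    IsAlgClosed.algebraMap_bijective_of_isIntegral
  refine ⟨e.symm.toAlgHom.comp (Ideal.Quotient.mkₐ ℂ Q), ?_⟩
  have h1 : (X - C b : ℂ[X]) ∈ RingHom.ker (evalRingHom b) := by simp [RingHom.mem_ker]
  rw [← hQP, Ideal.mem_comap, halg] at h1
  have h2 : Ideal.Quotient.mk Q x = Ideal.Quotient.mk Q (algebraMap ℂ R b) := by
    rw [Ideal.Quotient.eq]
    simpa using h1
  simp only [AlgHom.comp_apply, Ideal.Quotient.mkₐ_eq_mk, h2]
  exact (AlgEquiv.symm_apply_eq e).2 (e.commutes b).symm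

theorem exists_algEquiv_of_apply_eq {L : Type} [Field L] [Algebra ℂ L]
    [Algebra (RatFunc ℂ) L] [IsScalarTower ℂ (RatFunc ℂ) L] [FiniteDimensional (RatFunc ℂ) L]
    [IsGalois (RatFunc ℂ) L] (R : Subalgebra ℂ L)
    (hstab : ∀ (σ : L ≃ₐ[RatFunc ℂ] L), ∀ y ∈ R, σ y ∈ R)
    (x x' : R) (σ : L ≃ₐ[RatFunc ℂ] L) (hσ : σ x = x') {q : ℂ[X]}
    (hq : aeval (x : L) q = algebraMap (RatFunc ℂ) L RatFunc.X)
    (hR : ∀ y ∈ R, (aeval (x : L) : ℂ[X] →ₐ[ℂ] L).toRingHom.IsIntegralElem y)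
    (φ : R →ₐ[ℂ] ℂ) (hφ : φ x = φ x') :
    ∃ τ : L ≃ₐ[RatFunc ℂ] L, τ x = x' ∧ ∀ y : R, φ ⟨τ y, hstab τ y y.2⟩ = φ y := by
  let : Algebra ℂ[X] R := (aeval x : ℂ[X] →ₐ[ℂ] R).toAlgebra
  have halg : ∀ p, algebraMap ℂ[X] R p = aeval x p := fun _ => rfl
  let act : MulSemiringAction (L ≃ₐ[RatFunc ℂ] L) R :=
    { smul := fun σ y => ⟨σ y, hstab σ y y.2⟩
      one_smul := fun _ => rfl
      mul_smul := fun _ _ _ => rfl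
      smul_zero := fun σ => Subtype.ext (map_zero σ)
      smul_add := fun σ a b => Subtype.ext (map_add σ _ _)
      smul_one := fun σ => Subtype.ext (map_one σ)
      smul_mul := fun σ a b => Subtype.ext (map_mul σ _ _) }
  have hsmul : ∀ (σ : L ≃ₐ[RatFunc ℂ] L) (y : R), ((σ • y : R) : L) = σ y := fun _ _ => rfl
  have hsc : ∀ (σ : L ≃ₐ[RatFunc ℂ] L) (p : ℂ[X]) (y : R),
      σ • aeval y p = aeval (σ • y) p := fun σ p y => by
    apply Subtype.ext
    rw [hsmul, ← Subalgebra.aeval_coe, ← Subalgebra.aeval_coe, hsmul]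
    exact (aeval_algHom_apply (σ.toAlgHom.restrictScalars ℂ) _ _).symm
  let H : Subgroup (L ≃ₐ[RatFunc ℂ] L) := MulAction.stabilizer _ (x : L)
  have hH : ∀ σ : H, σ.1 x = x := fun σ => σ.2
  have : Finite (L ≃ₐ[RatFunc ℂ] L) := inferInstance
  have hinv : Algebra.IsInvariant ℂ[X] R H := by
    refine ⟨fun y hy => ?_⟩
    obtain ⟨p, hp⟩ := exists_aeval_eq_of_forall_fixed hq (hR y y.2)
      fun σ hσ => congrArg Subtype.val (hy ⟨σ, hσ⟩)
    exact ⟨p, Subtype.ext (by rw [halg, ← Subalgebra.aeval_coe, hp])⟩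
  have hcomm : SMulCommClass H ℂ[X] R := by
    refine ⟨fun τ p y => ?_⟩
    rw [Algebra.smul_def, Algebra.smul_def, smul_mul', halg]
    have h1 : τ • x = x := Subtype.ext (hH τ)
    have h2 : τ • aeval x p = aeval (τ • x) p := hsc τ.1 p x
    rw [h2, h1]
  let ψ : R →+* ℂ := φ.toRingHom.comp (MulSemiringAction.toRingHom _ R σ)
  have hψ : ∀ y, ψ y = φ (σ • y) := fun _ => rfl
  have hP : (RingHom.ker φ.toRingHom).IsPrime := RingHom.ker_isPrime _
  have hQ : (RingHom.ker ψ).IsPrime := RingHom.ker_isPrime _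
  obtain ⟨ρ, hρ⟩ := Algebra.IsInvariant.exists_smul_of_under_eq ℂ[X] R H
    (RingHom.ker φ.toRingHom) (RingHom.ker ψ) (by
      ext p
      rw [Ideal.under_def, Ideal.under_def, Ideal.mem_comap, Ideal.mem_comap, RingHom.mem_ker,
        RingHom.mem_ker, hψ, halg, hsc, show σ • x = x' from Subtype.ext hσ]
      simp only [AlgHom.toRingHom_eq_coe, RingHom.coe_coe, ← aeval_algHom_apply, hφ])
  refine ⟨σ * ρ.1, by rw [AlgEquiv.mul_apply, hH ρ, hσ], fun y => ?_⟩
  have h1 : ρ • (y - algebraMap ℂ R (φ y)) ∈ RingHom.ker ψ := by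
    rw [hρ]
    exact Ideal.smul_mem_pointwise_smul _ _ _ (by simp [RingHom.mem_ker])
  rw [RingHom.mem_ker, hψ] at h1
  have h2 : σ • ρ • (y - algebraMap ℂ R (φ y)) =
      ⟨(σ * ρ.1) y, hstab _ y y.2⟩ - algebraMap ℂ R (φ y) := by
    apply Subtype.ext
    change σ (ρ.1 ((y : L) - algebraMap ℂ L (φ y))) = σ (ρ.1 y) - algebraMap ℂ L (φ y)
    rw [IsScalarTower.algebraMap_apply ℂ (RatFunc ℂ) L]
    simp
  rw [h2, map_sub, AlgHom.commutes, sub_eq_zero] at h1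
  exact h1

theorem two_mul_eval_T_half_add_inv {F : Type} [Field F] [CharZero F] (a : F) (ha : a ≠ 0) (n : ℕ) :
    2 * (Chebyshev.T F n).eval ((a + a⁻¹) / 2) = a ^ n + a⁻¹ ^ n := by
  let : Invertible (2 : F) := invertibleOfNonzero two_ne_zero
  rw [← dickson_one_one_eval_add_inv a a⁻¹ (mul_inv_cancel₀ ha) n, dickson_one_one_eq_chebyshev_T]
  simp [div_eq_inv_mul]

theorem exists_half_add_inv_eq {F : Type} [Field F] [CharZero F] [IsAlgClosed F] (x : F) :
    ∃ a : F, a ≠ 0 ∧ x = (a + a⁻¹) / 2 := by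
  obtain ⟨s, hs⟩ := IsAlgClosed.exists_pow_nat_eq (x ^ 2 - 1) (n := 2) two_pos
  have h : (x + s) * (x - s) = 1 := by linear_combination -hs
  refine ⟨x + s, left_ne_zero_of_mul_eq_one h, ?_⟩
  rw [inv_eq_of_mul_eq_one_right h]
  ring

theorem half_add_inv_quadratic_relation {F : Type} [Field F] [CharZero F] {a w : F} (ha : a ≠ 0)
    (hw : w ≠ 0) :
    ((a + a⁻¹) / 2) ^ 2 + ((a * w + (a * w)⁻¹) / 2) ^ 2 -
      (w + w⁻¹) * ((a + a⁻¹) / 2) * ((a * w + (a * w)⁻¹) / 2) + ((w + w⁻¹) ^ 2 / 4 - 1) = 0 := by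
  field_simp
  ring

theorem exists_quadratic_relation_of_aeval_T_eq {F : Type} [Field F] [Algebra ℂ F] {d : ℕ}
    (hd : d ≠ 0) {x y : F}
    (h : aeval x (Chebyshev.T ℂ (d : ℤ)) = aeval y (Chebyshev.T ℂ (d : ℤ))) :
    ∃ c : ℂ, x ^ 2 + y ^ 2 - algebraMap ℂ F c * x * y + algebraMap ℂ F (c ^ 2 / 4 - 1) = 0 := by
  have : CharZero F := charZero_of_injective_algebraMap (algebraMap ℂ F).injective
  let Ω := AlgebraicClosure F
  let i : F →+* Ω := algebraMap F Ω
  have hi : Function.Injective i := i.injective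
  obtain ⟨a, ha, hxa⟩ := exists_half_add_inv_eq (i x)
  obtain ⟨b, hb, hyb⟩ := exists_half_add_inv_eq (i y)
  have key : ∀ u : F, i (aeval u (Chebyshev.T ℂ (d : ℤ))) = (Chebyshev.T Ω d).eval (i u) := by
    intro u
    rw [aeval_def, eval₂_eq_eval_map, Chebyshev.map_T, ← eval_map_apply, Chebyshev.map_T]
  have h1 : a ^ d + a⁻¹ ^ d = b ^ d + b⁻¹ ^ d := by
    rw [← two_mul_eval_T_half_add_inv a ha, ← two_mul_eval_T_half_add_inv b hb, ← hxa, ← hyb,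
      ← key, ← key, h]
  obtain ⟨b', hb', hyb', h2⟩ : ∃ b' : Ω, b' ≠ 0 ∧ i y = (b' + b'⁻¹) / 2 ∧ b' ^ d = a ^ d := by
    have h3 : (b ^ d - a ^ d) * (b ^ d - a⁻¹ ^ d) = 0 := by
      have e1 : b ^ d * b⁻¹ ^ d = 1 := by rw [← mul_pow, mul_inv_cancel₀ hb, one_pow]
      have e2 : a ^ d * a⁻¹ ^ d = 1 := by rw [← mul_pow, mul_inv_cancel₀ ha, one_pow]
      linear_combination -b ^ d * h1 + e2 - e1
    rcases mul_eq_zero.1 h3 with h3 | h3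
    · exact ⟨b, hb, hyb, sub_eq_zero.1 h3⟩
    · refine ⟨b⁻¹, inv_ne_zero hb, by rw [hyb, inv_inv, add_comm], ?_⟩
      rw [inv_pow, sub_eq_zero.1 h3, inv_pow, inv_inv]
  have h4 : (b' / a) ^ d = 1 := by rw [div_pow, h2, div_self (pow_ne_zero _ ha)]
  have : NeZero d := ⟨hd⟩
  obtain ⟨ω, hω⟩ : ∃ ω : ℂ, IsPrimitiveRoot ω d := ⟨_, Complex.isPrimitiveRoot_exp d hd⟩
  have hω' := hω.map_of_injective (f := i.comp (algebraMap ℂ F)) (RingHom.injective _)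
  obtain ⟨k, -, hk⟩ := hω'.eq_pow_of_pow_eq_one h4
  rw [← map_pow] at hk
  have hζ : ω ^ k ≠ 0 := pow_ne_zero _ (hω.ne_zero hd)
  generalize ω ^ k = ζ at hk hζ
  refine ⟨ζ + ζ⁻¹, hi ?_⟩
  have hb2 : b' = a * i (algebraMap ℂ F ζ) := by
    rw [← RingHom.comp_apply, hk, mul_div_cancel₀ _ ha]
  have hz : i (algebraMap ℂ F ζ) ≠ 0 := by simpa using hζ
  simp only [map_add, map_sub, map_mul, map_pow, map_div₀, map_inv₀, map_one, map_zero, hxa,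
    hyb', hb2, map_ofNat]
  generalize i (algebraMap ℂ F ζ) = w at hz
  exact half_add_inv_quadratic_relation ha hz

theorem eval_derivative_eq_zero_of_apply_eq {R : Type} [CommRing R] [IsDomain R] [Algebra ℂ R]
    (φ : R →ₐ[ℂ] ℂ) {x y : R} (hxy : x ≠ y) (hφ : φ x = φ y) {p : ℂ[X]}
    (hp : aeval x p = aeval y p) : (derivative p).eval (φ x) = 0 := by
  obtain ⟨k, hk⟩ := binomExpansion (p.map (algebraMap ℂ R)) x (y - x)
  have e : ∀ u (q : ℂ[X]), (q.map (algebraMap ℂ R)).eval u = aeval u q := fun u q => by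
    rw [aeval_def, eval₂_eq_eval_map]
  rw [add_sub_cancel, derivative_map, e, e, e, hp] at hk
  have h1 : (aeval x (derivative p) + k * (y - x)) * (y - x) = 0 := by linear_combination -hk
  have h2 := (mul_eq_zero.1 h1).resolve_right (sub_ne_zero.2 hxy.symm)
  have h3 := congrArg φ h2
  rw [map_add, map_mul, map_sub, hφ, sub_self, mul_zero, add_zero, map_zero,
    ← aeval_algHom_apply, hφ, coe_aeval_eq_eval] at h3
  rwa [hφ]

theorem aeval_algEquiv_apply {L : Type} [Field L] [Algebra ℂ L]
    [Algebra (RatFunc ℂ) L] [IsScalarTower ℂ (RatFunc ℂ) L] (σ : L ≃ₐ[RatFunc ℂ] L) (x : L)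
    (p : ℂ[X]) : aeval (σ x) p = σ (aeval x p) :=
  aeval_algHom_apply (σ.toAlgHom.restrictScalars ℂ) x p

theorem algEquiv_algebraMap_complex {L : Type} [Field L] [Algebra ℂ L]
    [Algebra (RatFunc ℂ) L] [IsScalarTower ℂ (RatFunc ℂ) L] (σ : L ≃ₐ[RatFunc ℂ] L) (c : ℂ) :
    σ (algebraMap ℂ L c) = algebraMap ℂ L c :=
  (σ.toAlgHom.restrictScalars ℂ).commutes c

theorem exists_algEquiv_fixing_of_apply_eq {L : Type} [Field L] [Algebra ℂ L]
    [Algebra (RatFunc ℂ) L] [IsScalarTower ℂ (RatFunc ℂ) L] [FiniteDimensional (RatFunc ℂ) L]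
    [IsGalois (RatFunc ℂ) L] (R : Subalgebra ℂ L)
    (hstab : ∀ (σ : L ≃ₐ[RatFunc ℂ] L), ∀ y ∈ R, σ y ∈ R) {f ftilde h : ℂ[X]}
    (hcomp : f = ftilde.comp h) (hmerge : CriticalValuesDoNotMerge ftilde h)
    (x x' : R) (σ : L ≃ₐ[RatFunc ℂ] L) (hσ : σ x = x')
    (hx : aeval (x : L) f = algebraMap (RatFunc ℂ) L RatFunc.X)
    (hR : ∀ y ∈ R, (aeval (x : L) : ℂ[X] →ₐ[ℂ] L).toRingHom.IsIntegralElem y)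
    (hxx' : x ≠ x') (hh : aeval (x : L) h = aeval (x' : L) h)
    (φ : R →ₐ[ℂ] ℂ) (hφ : φ x = φ x') :
    ∃ τ : L ≃ₐ[RatFunc ℂ] L, τ x = x' ∧ ∀ y ∈ R,
      aeval y f = algebraMap (RatFunc ℂ) L RatFunc.X → aeval y h ≠ aeval (x : L) h → τ y = y := by
  obtain ⟨τ, hτx, hτ⟩ := exists_algEquiv_of_apply_eq R hstab x x' σ hσ hx hR φ hφ
  refine ⟨τ, hτx, fun y hyR hyf hyh => ?_⟩
  by_contra hτy
  have hb : (derivative h).eval (φ x) = 0 := by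
    refine eval_derivative_eq_zero_of_apply_eq φ hxx' hφ (Subtype.ext ?_)
    rw [← Subalgebra.aeval_coe, ← Subalgebra.aeval_coe, hh]
  lift y to R using hyR
  have hev : ∀ (u : R) (p : ℂ[X]), p.eval (φ u) = φ (aeval u p) := fun u p => by
    rw [← aeval_algHom_apply, coe_aeval_eq_eval]
  have hf : (derivative f).eval (φ y) = 0 := by
    refine eval_derivative_eq_zero_of_apply_eq φ (y := ⟨τ y, hstab τ y y.2⟩)
      (fun e => hτy (congrArg Subtype.val e).symm) (hτ y).symm (Subtype.ext ?_)
    rw [← Subalgebra.aeval_coe, ← Subalgebra.aeval_coe, aeval_algEquiv_apply, hyf,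
      AlgEquiv.commutes]
  have hxy : aeval y f = aeval x f :=
    Subtype.ext (by rw [← Subalgebra.aeval_coe, ← Subalgebra.aeval_coe, hx, hyf])
  have hval : (ftilde.comp h).eval (φ y) = (ftilde.comp h).eval (φ x) := by
    rw [← hcomp, hev, hev, hxy]
  rw [hcomp, derivative_comp, eval_mul, eval_comp, mul_eq_zero] at hf
  refine hmerge.1 ⟨φ y, φ x, ?_, hb, hval⟩
  rcases hf with hf | hf
  swap
  · exact hf
  have h1 : h.eval (φ y) = h.eval (φ x) :=
    hmerge.2 _ _ hf hb (by simpa only [eval_comp] using hval)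
  rw [hev y h]
  refine eval_derivative_eq_zero_of_apply_eq φ (y := aeval x h) (fun e => hyh ?_)
    (by rw [← hev, ← hev, h1]) ?_
  · rw [Subalgebra.aeval_coe, Subalgebra.aeval_coe, e]
  · rw [← aeval_comp, ← aeval_comp, ← hcomp, hxy]

theorem exists_algHom_apply_eq_apply_or {L : Type} [Field L] [Algebra ℂ L]
    [Algebra (RatFunc ℂ) L] [IsScalarTower ℂ (RatFunc ℂ) L] (R : Subalgebra ℂ L)
    [Algebra.FiniteType ℂ R] (x x₁ x₂ : R) (hx : Transcendental ℂ (x : L))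
    (hR : ∀ y ∈ R, (aeval (x : L) : ℂ[X] →ₐ[ℂ] L).toRingHom.IsIntegralElem y)
    (s : L ≃ₐ[RatFunc ℂ] L) (hx₁ : s x = x₁) (hx₂ : s x₂ = x) {d : ℕ} (hd : 1 < d) {h : ℂ[X]}
    (hhmc : h = X ^ d ∨ h = Chebyshev.T ℂ (d : ℤ))
    (hh : aeval (x : L) h = aeval (x₁ : L) h) (hd2 : x₁ = x₂ → d = 2) :
    ∃ φ : R →ₐ[ℂ] ℂ, φ x = φ x₁ ∨ φ x = φ x₂ := by
  have hhR : aeval x h = aeval x₁ h :=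
    Subtype.ext (by rw [← Subalgebra.aeval_coe, ← Subalgebra.aeval_coe, hh])
  rcases hhmc with rfl | rfl
  · obtain ⟨φ, hφ⟩ := exists_algHom_apply_eq R x hx hR 0
    refine ⟨φ, Or.inl ?_⟩
    have h1 := congrArg φ hhR
    simp only [map_pow, aeval_X, hφ] at h1
    rw [zero_pow (by omega)] at h1
    rw [hφ, eq_zero_of_pow_eq_zero h1.symm]
  · by_cases h12 : x₁ = x₂
    · obtain rfl := hd2 h12
      obtain ⟨φ, hφ⟩ := exists_algHom_apply_eq R x hx hR 0
      refine ⟨φ, Or.inl ?_⟩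
      have h1 := congrArg φ hhR
      simp only [Nat.cast_ofNat, Chebyshev.T_two] at h1
      simp only [map_sub, map_mul, map_pow, map_ofNat, map_one, aeval_X, hφ] at h1
      have h2 : φ x₁ ^ 2 = 0 := by linear_combination -h1 / 2
      rw [hφ, eq_zero_of_pow_eq_zero h2]
    · obtain ⟨c, hc⟩ := exists_quadratic_relation_of_aeval_T_eq (by omega) hh
      obtain ⟨b, hb⟩ := IsAlgClosed.exists_pow_nat_eq ((2 + c) / 4) (n := 2) two_pos
      obtain ⟨φ, hφ⟩ := exists_algHom_apply_eq R x hx hR b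
      refine ⟨φ, ?_⟩
      have hc2 : (x₂ : L) ^ 2 + x ^ 2 - algebraMap ℂ L c * x₂ * x +
          algebraMap ℂ L (c ^ 2 / 4 - 1) = 0 := by
        apply s.injective
        simp only [map_add, map_sub, map_mul, map_pow (s : L ≃ₐ[RatFunc ℂ] L),
          algEquiv_algebraMap_complex, hx₁, hx₂, map_zero]
        simpa only [map_sub] using hc
      have hsum : x₁ + x₂ = algebraMap ℂ R c * x := by
        apply Subtype.ext
        have h3 : (x₁ : L) - x₂ ≠ 0 := sub_ne_zero.2 fun e => h12 (Subtype.ext e)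
        have h4 : ((x₁ : L) - x₂) * (x₁ + x₂ - algebraMap ℂ L c * x) = 0 := by
          linear_combination hc - hc2
        exact sub_eq_zero.1 ((mul_eq_zero.1 h4).resolve_left h3)
      have hcR : x ^ 2 + x₁ ^ 2 - algebraMap ℂ R c * x * x₁ +
          algebraMap ℂ R (c ^ 2 / 4 - 1) = 0 := Subtype.ext hc
      have h5 := congrArg φ hcR
      have h6 := congrArg φ hsum
      simp only [map_add, map_sub, map_mul, map_pow, AlgHom.commutes, hφ, map_zero,
        Algebra.algebraMap_self, RingHom.id_apply] at h5 h6
      rw [hφ]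
      have h7 : (b - φ x₁) * (φ x₁ - (c - 1) * b) = 0 := by
        linear_combination -h5 + (2 - c) * hb
      rcases mul_eq_zero.1 h7 with h7 | h7
      · exact Or.inl (sub_eq_zero.1 h7)
      · right
        linear_combination h7 - h6

theorem finite_setOf_aeval_eq {L : Type} [Field L] [Algebra ℂ L] {f : ℂ[X]} (hf : f.Monic)
    (hdeg : f.natDegree ≠ 0) (t : L) : {y : L | aeval y f = t}.Finite := by
  have h0 : f.map (algebraMap ℂ L) - C t ≠ 0 := by
    intro h
    have := congrArg natDegree h
    rw [natDegree_sub_C, hf.natDegree_map, natDegree_zero] at this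
    exact hdeg this
  refine (finite_setOfPred_isRoot h0).subset fun y hy => ?_
  simp only [Set.mem_ofPred_eq, IsRoot.def, eval_sub, eval_C, eval_map_algebraMap] at hy ⊢
  rw [hy, sub_self]

theorem isIntegralElem_of_mem_adjoin {L : Type} [Field L] [Algebra ℂ L] {f q : ℂ[X]}
    (hf : f.Monic) {x t : L} (hq : aeval x q = t) (hdeg : f.natDegree ≠ 0) :
    ∀ y ∈ Algebra.adjoin ℂ {y : L | aeval y f = t},
      (aeval x : ℂ[X] →ₐ[ℂ] L).toRingHom.IsIntegralElem y := by
  let : Algebra ℂ[X] L := (aeval x : ℂ[X] →ₐ[ℂ] L).toAlgebra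
  have : IsScalarTower ℂ ℂ[X] L := IsScalarTower.of_algHom (aeval x : ℂ[X] →ₐ[ℂ] L)
  have hle : Algebra.adjoin ℂ {y : L | aeval y f = t} ≤
      (integralClosure ℂ[X] L).restrictScalars ℂ := by
    refine Algebra.adjoin_le fun y hy => ?_
    refine ⟨f.map C - C q, (hf.map C).sub_of_left ?_, ?_⟩
    · refine degree_C_le.trans_lt ?_
      rw [hf.degree_map, degree_eq_natDegree hf.ne_zero]
      exact_mod_cast Nat.pos_of_ne_zero hdeg
    · rw [eval₂_sub, eval₂_map, eval₂_C]
      have h1 : (algebraMap ℂ[X] L).comp C = algebraMap ℂ L :=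
        (IsScalarTower.algebraMap_eq ℂ ℂ[X] L).symm
      rw [h1, ← aeval_def]
      exact sub_eq_zero.2 (Eq.trans hy hq.symm)
  exact hle

theorem algEquiv_mem_adjoin {L : Type} [Field L] [Algebra ℂ L]
    [Algebra (RatFunc ℂ) L] [IsScalarTower ℂ (RatFunc ℂ) L] {f : ℂ[X]}
    (σ : L ≃ₐ[RatFunc ℂ] L) :
    ∀ y ∈ Algebra.adjoin ℂ {y : L | aeval y f = algebraMap (RatFunc ℂ) L RatFunc.X},
      σ y ∈ Algebra.adjoin ℂ {y : L | aeval y f = algebraMap (RatFunc ℂ) L RatFunc.X} := by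
  have hle : Algebra.adjoin ℂ {y : L | aeval y f = algebraMap (RatFunc ℂ) L RatFunc.X} ≤
      (Algebra.adjoin ℂ {y : L | aeval y f = algebraMap (RatFunc ℂ) L RatFunc.X}).comap
        (σ.toAlgHom.restrictScalars ℂ) := by
    refine Algebra.adjoin_le fun y hy => Algebra.subset_adjoin ?_
    change aeval (σ y) f = _
    rw [aeval_algEquiv_apply, hy, AlgEquiv.commutes]
  exact hle

/-- The elements of the Galois group acting on a single block of `h`, namely that of `x`, connect
`x` with its images under the iterates of an automorphism preserving this block. -/
theorem exists_algEquiv_fixing_pow {L : Type} [Field L] [Algebra ℂ L]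
    [Algebra (RatFunc ℂ) L] [IsScalarTower ℂ (RatFunc ℂ) L] [FiniteDimensional (RatFunc ℂ) L]
    [IsGalois (RatFunc ℂ) L] {d : ℕ} (hd : 1 < d) {f ftilde h : ℂ[X]}
    (hf : f.Monic) (hdeg : f.natDegree ≠ 0)
    (hcomp : f = ftilde.comp h) (hhmc : h = X ^ d ∨ h = Chebyshev.T ℂ (d : ℤ))
    (hmerge : CriticalValuesDoNotMerge ftilde h) {x : L}
    (hx : aeval x f = algebraMap (RatFunc ℂ) L RatFunc.X) (s : L ≃ₐ[RatFunc ℂ] L)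
    (hs : aeval (s x) h = aeval x h) (hne : s x ≠ x) (hd2 : s (s x) = x → d = 2) (k : ℕ) :
    ∃ τ : L ≃ₐ[RatFunc ℂ] L, τ x = (s ^ k) x ∧ ∀ y : L,
      aeval y f = algebraMap (RatFunc ℂ) L RatFunc.X → aeval y h ≠ aeval x h → τ y = y := by
  set t : L := algebraMap (RatFunc ℂ) L RatFunc.X with ht
  let R := Algebra.adjoin ℂ {y : L | aeval y f = t}
  have hft : Algebra.FiniteType ℂ R := .adjoin_of_finite (finite_setOf_aeval_eq hf hdeg t)
  have hroot : ∀ y : L, aeval y f = t → y ∈ R := fun y hy => Algebra.subset_adjoin hy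
  have hstab : ∀ (σ : L ≃ₐ[RatFunc ℂ] L), ∀ y ∈ R, σ y ∈ R := algEquiv_mem_adjoin
  have hsx : ∀ σ : L ≃ₐ[RatFunc ℂ] L, aeval (σ x) f = t := fun σ => by
    rw [aeval_algEquiv_apply, hx, AlgEquiv.commutes]
  let P : L → L → Prop := fun u v => ∃ τ : L ≃ₐ[RatFunc ℂ] L, τ u = v ∧ ∀ y : L,
    aeval y f = t → aeval y h ≠ aeval x h → τ y = y
  have hPsymm : ∀ u v, P u v → P v u := by
    rintro u v ⟨τ, rfl, hτ⟩
    exact ⟨τ.symm, τ.symm_apply_apply u, fun y hy hyh =>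
      (AlgEquiv.symm_apply_eq τ).2 (hτ y hy hyh).symm⟩
  have hPtrans : ∀ u v w, P u v → P v w → P u w := by
    rintro u v w ⟨τ, rfl, hτ⟩ ⟨τ', rfl, hτ'⟩
    exact ⟨τ' * τ, rfl, fun y hy hyh => by
      rw [AlgEquiv.mul_apply, hτ y hy hyh, hτ' y hy hyh]⟩
  have hPconj : ∀ u v, P u v → P (s u) (s v) := by
    rintro u v ⟨τ, rfl, hτ⟩
    refine ⟨s * τ * s.symm, by simp [AlgEquiv.mul_apply], fun y hy hyh => ?_⟩
    rw [AlgEquiv.mul_apply, AlgEquiv.mul_apply, hτ, AlgEquiv.apply_symm_apply]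
    · rw [aeval_algEquiv_apply, hy, AlgEquiv.commutes]
    · intro e
      refine hyh ?_
      rw [← hs, aeval_algEquiv_apply s x, ← e, aeval_algEquiv_apply, AlgEquiv.apply_symm_apply]
  have hP1 : P x (s x) := by
    have hlocal : ∀ (σ : L ≃ₐ[RatFunc ℂ] L) (φ : R →ₐ[ℂ] ℂ),
        aeval (σ x) h = aeval x h → σ x ≠ x →
        φ ⟨x, hroot x hx⟩ = φ ⟨σ x, hroot _ (hsx σ)⟩ → P x (σ x) := by
      intro σ φ hσ hσx hφ
      obtain ⟨τ, hτ, hτ'⟩ := exists_algEquiv_fixing_of_apply_eq R hstab hcomp hmerge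
        ⟨x, hroot x hx⟩ ⟨σ x, hroot _ (hsx σ)⟩ σ rfl hx (isIntegralElem_of_mem_adjoin hf hx hdeg)
        (fun e => hσx (congrArg Subtype.val e).symm) hσ.symm φ hφ
      exact ⟨τ, hτ, fun y hy => hτ' y (hroot y hy) hy⟩
    have hs' : aeval (s.symm x) h = aeval x h := by
      apply s.injective
      rw [← aeval_algEquiv_apply, ← aeval_algEquiv_apply, AlgEquiv.apply_symm_apply, hs]
    obtain ⟨φ, hφ | hφ⟩ := exists_algHom_apply_eq_apply_or R ⟨x, hroot x hx⟩
      ⟨s x, hroot _ (hsx s)⟩ ⟨s.symm x, hroot _ (hsx s.symm)⟩ (transcendental_of_aeval_eq_X hx)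
      (isIntegralElem_of_mem_adjoin hf hx hdeg) s rfl (s.apply_symm_apply x) hd hhmc hs.symm
      (fun e => hd2 (by
        rw [show s x = s.symm x from congrArg Subtype.val e, AlgEquiv.apply_symm_apply]))
    · exact hlocal s φ hs hne hφ
    · have h1 := hPconj _ _ (hlocal s.symm φ hs'
        (fun e => hne ((AlgEquiv.symm_apply_eq s).1 e).symm) hφ)
      rw [AlgEquiv.apply_symm_apply] at h1
      exact hPsymm _ _ h1
  change P x ((s ^ k) x)
  induction k with
  | zero => exact ⟨1, rfl, fun _ _ _ => rfl⟩
  | succ k ih =>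
    rw [pow_succ', AlgEquiv.mul_apply]
    exact hPtrans _ _ _ hP1 (hPconj _ _ ih)

theorem isGalois_ratFunc_of_isSplittingField {L : Type} [Field L] [Algebra (RatFunc ℂ) L]
    (p : (RatFunc ℂ)[X]) (hp : p.IsSplittingField (RatFunc ℂ) L) : IsGalois (RatFunc ℂ) L := by
  have : CharZero (RatFunc ℂ) :=
    charZero_of_injective_algebraMap (algebraMap ℂ (RatFunc ℂ)).injective
  have := Normal.of_isSplittingField (F := RatFunc ℂ) (E := L) p
  exact ⟨⟩

theorem exists_eq_of_aeval_eq {L : Type} [Field L] [Algebra ℂ L] {f : ℂ[X]} (hf : f.Monic)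
    {m : ℕ} (hm : f.natDegree = m) (hm0 : m ≠ 0) {t : L} {z : Fin m → L}
    (hzinj : Function.Injective z) (hz : ∀ i, aeval (z i) f = t) {y : L} (hy : aeval y f = t) :
    ∃ i, z i = y := by
  classical
  have hq : (f.map (algebraMap ℂ L) - C t).natDegree = m := by
    rw [natDegree_sub_C, hf.natDegree_map, hm]
  have h0 : f.map (algebraMap ℂ L) - C t ≠ 0 := by
    intro h
    rw [h, natDegree_zero] at hq
    exact hm0 hq.symm
  have hmem : ∀ x, aeval x f = t → x ∈ (f.map (algebraMap ℂ L) - C t).roots.toFinset := by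
    intro x hx
    rw [Multiset.mem_toFinset, mem_roots h0, IsRoot.def, eval_sub, eval_C, eval_map_algebraMap, hx,
      sub_self]
  have heq : Finset.univ.image z = (f.map (algebraMap ℂ L) - C t).roots.toFinset := by
    refine Finset.eq_of_subset_of_card_le ?_ ?_
    · intro x hx
      obtain ⟨i, -, rfl⟩ := Finset.mem_image.1 hx
      exact hmem _ (hz i)
    · rw [Finset.card_image_of_injective _ hzinj, Finset.card_univ, Fintype.card_fin]
      exact (Multiset.toFinset_card_le _).trans ((card_roots' _).trans hq.le)
  have h1 := hmem y hy
  rw [← heq] at h1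
  obtain ⟨i, -, hi⟩ := Finset.mem_image.1 h1
  exact ⟨i, hi⟩

theorem exists_perm_of_algEquiv {L : Type} [Field L] [Algebra ℂ L]
    [Algebra (RatFunc ℂ) L] [IsScalarTower ℂ (RatFunc ℂ) L] {f : ℂ[X]} (hf : f.Monic)
    {m : ℕ} (hm : f.natDegree = m) (hm0 : m ≠ 0) {z : Fin m → L}
    (hzinj : Function.Injective z)
    (hz : ∀ i, aeval (z i) f = algebraMap (RatFunc ℂ) L RatFunc.X) (σ : L ≃ₐ[RatFunc ℂ] L) :
    ∃ π : Equiv.Perm (Fin m), ∀ i, σ (z i) = z (π i) := by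
  have h1 : ∀ i, ∃ j, z j = σ (z i) := fun i =>
    exists_eq_of_aeval_eq hf hm hm0 hzinj hz (by
      rw [aeval_algEquiv_apply, hz, AlgEquiv.commutes])
  choose π hπ using h1
  have hinj : Function.Injective π := fun i j hij =>
    hzinj (σ.injective (by rw [← hπ, ← hπ, hij]))
  exact ⟨Equiv.ofBijective π (Finite.injective_iff_bijective.1 hinj), fun i => (hπ i).symm⟩

theorem card_mul_sum_mul_eq_of_transitive {ι A : Type*} [Fintype ι] [DecidableEq ι] [Field A]
    [CharZero A] (B : Finset ι) (P : Equiv.Perm ι → Prop) (hone : P 1)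
    (hmul : ∀ π ρ, P π → P ρ → P (π * ρ)) (hfix : ∀ π, P π → ∀ i ∉ B, π i = i)
    (htrans : ∀ i ∈ B, ∀ j ∈ B, ∃ π, P π ∧ π i = j) (a F : ι → A)
    (hsum : ∀ π, P π → ∑ i, a i * F (π i) = 0) :
    (B.card : A) * ∑ i ∈ B, a i * F i = (∑ i ∈ B, a i) * ∑ i ∈ B, F i := by
  classical
  let H : Finset (Equiv.Perm ι) := {π | P π}
  have hH : ∀ π, π ∈ H ↔ P π := fun π => by simp [H]
  have hmem : ∀ π ∈ H, ∀ i, i ∈ B ↔ π i ∈ B := by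
    intro π hπ i
    have h1 := hfix π ((hH π).1 hπ)
    constructor
    · intro hi
      by_contra h
      exact h (by rwa [π.injective (h1 _ h)])
    · intro hi
      by_contra h
      exact h (h1 i h ▸ hi)
  have hc : ∀ π ∈ H, ∑ i ∈ B, a i * F (π i) = ∑ i ∈ B, a i * F i := by
    intro π hπ
    have h1 := hsum π ((hH π).1 hπ)
    have h2 := hsum 1 hone
    rw [← Finset.sum_add_sum_compl B] at h1 h2
    have h3 : ∑ i ∈ Bᶜ, a i * F (π i) = ∑ i ∈ Bᶜ, a i * F i :=
      Finset.sum_congr rfl fun i hi => by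
        rw [hfix π ((hH π).1 hπ) i (Finset.mem_compl.1 hi)]
    simp only [Equiv.Perm.coe_one, id_eq] at h2
    linear_combination h1 - h2 - h3
  have hind : ∀ i ∈ B, ∀ j ∈ B, ∑ π ∈ H, F (π i) = ∑ π ∈ H, F (π j) := by
    intro i hi j hj
    obtain ⟨ρ, hρ, hij⟩ := htrans j hj i hi
    have himg : H.map (Equiv.mulRight ρ).toEmbedding = H := by
      refine Finset.eq_of_subset_of_card_le ?_ (by rw [Finset.card_map])
      intro π hπ
      obtain ⟨π', hπ', rfl⟩ := Finset.mem_map.1 hπ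
      exact (hH _).2 (hmul _ _ ((hH _).1 hπ') hρ)
    conv_rhs => rw [← himg, Finset.sum_map]
    exact Finset.sum_congr rfl fun π _ => by simp [hij]
  have hFB : ∀ π ∈ H, ∑ i ∈ B, F (π i) = ∑ i ∈ B, F i := fun π hπ =>
    Finset.sum_equiv π (hmem π hπ) fun _ _ => rfl
  rcases B.eq_empty_or_nonempty with rfl | ⟨i₀, hi₀⟩
  · simp
  have h1 : (H.card : A) * ∑ i ∈ B, a i * F i = (∑ i ∈ B, a i) * ∑ π ∈ H, F (π i₀) := by
    rw [← nsmul_eq_mul, ← Finset.sum_const, ← Finset.sum_congr rfl hc, Finset.sum_comm,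
      Finset.sum_mul]
    exact Finset.sum_congr rfl fun i hi => by rw [← Finset.mul_sum, hind i hi i₀ hi₀]
  have h2 : (B.card : A) * ∑ π ∈ H, F (π i₀) = H.card * ∑ i ∈ B, F i := by
    rw [← nsmul_eq_mul, ← Finset.sum_const, Finset.sum_congr rfl fun i hi => hind i₀ hi₀ i hi,
      Finset.sum_comm, Finset.sum_congr rfl hFB, Finset.sum_const, nsmul_eq_mul]
  have h3 : (H.card : A) ≠ 0 :=
    Nat.cast_ne_zero.2 (Finset.card_ne_zero_of_mem ((hH 1).2 hone))
  refine mul_left_cancel₀ h3 ?_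
  linear_combination (B.card : A) * h1 + (∑ i ∈ B, a i) * h2

theorem sum_filter_mod_eq_sum_range {A : Type*} [AddCommMonoid A] {m d r : ℕ} (hmr : m = d * r)
    {l : ℕ} (hl : l < r) (hm0 : 0 < m) (F : Fin m → A) :
    ∑ i : Fin m with i.val % r = l, F i =
      ∑ j ∈ Finset.range d, F ⟨(l + j * r) % m, Nat.mod_lt _ hm0⟩ := by
  have hlt : ∀ j < d, l + j * r < m := fun j hj => by
    have := Nat.mul_le_mul_right r (Nat.succ_le_of_lt hj)
    rw [Nat.succ_mul] at this
    omega
  symm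
  refine Finset.sum_bij' (fun j _ => ⟨(l + j * r) % m, Nat.mod_lt _ hm0⟩)
    (fun i _ => (i : ℕ) / r) ?_ ?_ ?_ ?_ ?_
  · intro j hj
    simp [Nat.mod_eq_of_lt (hlt j (Finset.mem_range.1 hj)), Nat.mod_eq_of_lt hl]
  · intro i hi
    rw [Finset.mem_range]
    exact Nat.div_lt_of_lt_mul (by rw [mul_comm, ← hmr]; exact i.2)
  · intro j hj
    simp only [Nat.mod_eq_of_lt (hlt j (Finset.mem_range.1 hj))]
    rw [Nat.add_mul_div_right _ _ (by omega), Nat.div_eq_of_lt hl, zero_add]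
  · intro i hi
    simp only [Finset.mem_filter, Finset.mem_univ, true_and] at hi
    apply Fin.ext
    simp only [← hi]
    rw [mul_comm, Nat.mod_add_div, Nat.mod_eq_of_lt i.2]
  · intro _ _
    rfl

theorem sum_eq_sum_range_sum_filter_mod {A : Type*} [AddCommMonoid A] {m r : ℕ} (hr : 0 < r)
    (F : Fin m → A) :
    ∑ i, F i = ∑ l ∈ Finset.range r, ∑ i : Fin m with i.val % r = l, F i :=
  (Finset.sum_fiberwise_of_maps_to (fun _ _ => Finset.mem_range.2 (Nat.mod_lt _ hr)) F).symm

theorem aeval_mem_adjoin_of_aeval_eq {L : Type} [Field L] [Algebra ℂ L] {f : ℂ[X]} {x t : L}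
    (hx : aeval x f = t) (g : ℂ[X]) : aeval x g ∈ Algebra.adjoin ℂ {y : L | aeval y f = t} := by
  have hmem : x ∈ Algebra.adjoin ℂ {y : L | aeval y f = t} := Algebra.subset_adjoin hx
  rw [← show ((⟨x, hmem⟩ : Algebra.adjoin ℂ {y : L | aeval y f = t}) : L) = x from rfl,
    Subalgebra.aeval_coe]
  exact SetLike.coe_mem _

/-- The sums of `g` over the fibres of `h` are the values of a polynomial in `h`. -/
theorem exists_forall_sum_fiber_eq_aeval {L : Type} [Field L] [Algebra ℂ L]
    [Algebra (RatFunc ℂ) L] [IsScalarTower ℂ (RatFunc ℂ) L] [FiniteDimensional (RatFunc ℂ) L]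
    [IsGalois (RatFunc ℂ) L] [DecidableEq L] {f ftilde h : ℂ[X]} (hf : f.Monic)
    (hcomp : f = ftilde.comp h)
    {m : ℕ} (hm : f.natDegree = m) (hm0 : m ≠ 0) {z : Fin m → L} (hzinj : Function.Injective z)
    (hz : ∀ i, aeval (z i) f = algebraMap (RatFunc ℂ) L RatFunc.X)
    (htrans : ∀ i j, ∃ σ : L ≃ₐ[RatFunc ℂ] L, σ (z i) = z j) (g : ℂ[X]) :
    ∃ G : ℂ[X], ∀ l, ∑ i with aeval (z i) h = aeval (z l) h, aeval (z i) g =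
      aeval (z l) (G.comp h) := by
  have hσ : ∀ (σ : L ≃ₐ[RatFunc ℂ] L) (w : L),
      σ (∑ i with aeval (z i) h = w, aeval (z i) g) =
        ∑ i with aeval (z i) h = σ w, aeval (z i) g := by
    intro σ w
    obtain ⟨π, hπ⟩ := exists_perm_of_algEquiv hf hm hm0 hzinj hz σ
    rw [map_sum]
    refine Finset.sum_equiv π (fun i => ?_) fun i _ => ?_
    · simp only [Finset.mem_filter, Finset.mem_univ, true_and, ← hπ, aeval_algEquiv_apply,
        σ.injective.eq_iff]
    · rw [← hπ, aeval_algEquiv_apply]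
  let i₀ : Fin m := ⟨0, by omega⟩
  have hq : aeval (aeval (z i₀) h) ftilde = algebraMap (RatFunc ℂ) L RatFunc.X := by
    rw [← aeval_comp, ← hcomp, hz]
  have hmem : ∑ i with aeval (z i) h = aeval (z i₀) h, aeval (z i) g ∈
      Algebra.adjoin ℂ {y : L | aeval y f = algebraMap (RatFunc ℂ) L RatFunc.X} :=
    sum_mem fun i _ => aeval_mem_adjoin_of_aeval_eq (hz i) g
  obtain ⟨G, hG⟩ := exists_aeval_eq_of_forall_fixed hq
    (y := ∑ i with aeval (z i) h = aeval (z i₀) h, aeval (z i) g)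
    (isIntegralElem_of_mem_adjoin hf hq (by omega) _ hmem)
    (fun σ h => by rw [hσ, h])
  refine ⟨G, fun l => ?_⟩
  obtain ⟨σ, h1⟩ := htrans i₀ l
  rw [← h1, aeval_algEquiv_apply, ← hσ, ← hG, aeval_algEquiv_apply, aeval_comp]

theorem sum_range_mul_pow_eq_zero_of_isPrimitiveRoot {d : ℕ} (hd : 0 < d) {ζ ξ : ℂ}
    (hζ : IsPrimitiveRoot ζ d) (hξ : IsPrimitiveRoot ξ d) (c : ℕ → ℤ)
    (h : ∑ j ∈ Finset.range d, (c j : ℂ) * ζ ^ j = 0) :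
    ∑ j ∈ Finset.range d, (c j : ℂ) * ξ ^ j = 0 := by
  let p : ℤ[X] := ∑ j ∈ Finset.range d, C (c j) * X ^ j
  have hp : ∀ x : ℂ, aeval x p = ∑ j ∈ Finset.range d, (c j : ℂ) * x ^ j := fun x => by
    simp [p]
  have hdvd : cyclotomic d ℤ ∣ p := by
    rw [cyclotomic_eq_minpoly hζ hd]
    exact minpoly.isIntegrallyClosed_dvd (hζ.isIntegral hd) (by rw [hp, h])
  obtain ⟨q, hq⟩ := hdvd
  rw [← hp, hq, map_mul, cyclotomic_eq_minpoly hξ hd, minpoly.aeval, zero_mul]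

/-- If `F` is paired to zero with `a` along the Galois orbit, then the same holds, up to the product
of the means, on each block. -/
theorem card_mul_sum_filter_mod_eq {L : Type} [Field L] [Algebra ℂ L]
    [Algebra (RatFunc ℂ) L] [IsScalarTower ℂ (RatFunc ℂ) L] {A : Type*} [Field A] [CharZero A]
    {f : ℂ[X]} (hf : f.Monic) {m r : ℕ} (hm : f.natDegree = m) (hm0 : m ≠ 0) {z : Fin m → L}
    (hzinj : Function.Injective z)
    (hz : ∀ i, aeval (z i) f = algebraMap (RatFunc ℂ) L RatFunc.X)
    (htrans : ∀ i j : Fin m, i.val % r = j.val % r → ∃ σ : L ≃ₐ[RatFunc ℂ] L, σ (z i) = z j ∧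
      ∀ k : Fin m, k.val % r ≠ i.val % r → σ (z k) = z k) (a F : Fin m → A)
    (hsum : ∀ (σ : L ≃ₐ[RatFunc ℂ] L) (π : Equiv.Perm (Fin m)), (∀ i, σ (z i) = z (π i)) →
      ∑ i, a i * F (π i) = 0) (l : ℕ) :
    ((Finset.univ.filter fun i : Fin m => i.val % r = l).card : A) *
        ∑ i : Fin m with i.val % r = l, a i * F i =
      (∑ i : Fin m with i.val % r = l, a i) * ∑ i : Fin m with i.val % r = l, F i := by
  refine card_mul_sum_mul_eq_of_transitive _
    (fun π => (∃ σ : L ≃ₐ[RatFunc ℂ] L, ∀ i, σ (z i) = z (π i)) ∧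
      ∀ i : Fin m, i.val % r ≠ l → π i = i) ⟨⟨1, fun _ => rfl⟩, fun _ _ => rfl⟩ ?_ ?_ ?_ a F ?_
  · rintro π ρ ⟨⟨σ, hσ⟩, hπ⟩ ⟨⟨τ, hτ⟩, hρ⟩
    refine ⟨⟨σ * τ, fun i => ?_⟩, fun i hi => ?_⟩
    · rw [AlgEquiv.mul_apply, hτ, hσ, Equiv.Perm.mul_apply]
    · rw [Equiv.Perm.mul_apply, hρ i hi, hπ i hi]
  · rintro π ⟨-, hπ⟩ i hi
    exact hπ i (by simpa using hi)
  · intro i hi j hj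
    simp only [Finset.mem_filter, Finset.mem_univ, true_and] at hi hj
    obtain ⟨σ, hσ, hfix⟩ := htrans i j (hi.trans hj.symm)
    obtain ⟨π, hπ⟩ := exists_perm_of_algEquiv hf hm hm0 hzinj hz σ
    refine ⟨π, ⟨⟨σ, hπ⟩, fun k hk => hzinj ?_⟩, hzinj ?_⟩
    · rw [← hπ, hfix k (hi ▸ hk)]
    · rw [← hπ, hσ]
  · rintro π ⟨⟨σ, hσ⟩, -⟩
    exact hsum σ π hσ

theorem algEquiv_pow_apply_eq {L : Type} [Field L] [Algebra (RatFunc ℂ) L] {m : ℕ} (hm0 : 0 < m)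
    {z : Fin m → L} (σ : L ≃ₐ[RatFunc ℂ] L)
    (hσ : ∀ i : Fin m, σ (z i) = z ⟨((i : ℕ) + 1) % m, Nat.mod_lt _ hm0⟩) (k : ℕ) (i : Fin m) :
    (σ ^ k) (z i) = z ⟨((i : ℕ) + k) % m, Nat.mod_lt _ hm0⟩ := by
  induction k with
  | zero => simp [Nat.mod_eq_of_lt i.2]
  | succ k ih =>
    rw [pow_succ', AlgEquiv.mul_apply, ih, hσ]
    simp only [Nat.mod_add_mod, add_assoc]

/-- The subgroup of the Galois group fixing the roots outside a block is transitive on it. -/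
theorem exists_algEquiv_fixing_of_mod_eq {L : Type} [Field L] [Algebra ℂ L]
    [Algebra (RatFunc ℂ) L] [IsScalarTower ℂ (RatFunc ℂ) L] [FiniteDimensional (RatFunc ℂ) L]
    [IsGalois (RatFunc ℂ) L] {m d r : ℕ} (hd : 1 < d) (hmr : m = d * r) (hm0 : 0 < m)
    {f ftilde h : ℂ[X]} (hf : f.Monic) (hm : f.natDegree = m)
    (hcomp : f = ftilde.comp h) (hhmc : h = X ^ d ∨ h = Chebyshev.T ℂ (d : ℤ))
    (hmerge : CriticalValuesDoNotMerge ftilde h) {z : Fin m → L} (hzinj : Function.Injective z)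
    (hz : ∀ i, aeval (z i) f = algebraMap (RatFunc ℂ) L RatFunc.X) (σ : L ≃ₐ[RatFunc ℂ] L)
    (hσ : ∀ i : Fin m, σ (z i) = z ⟨((i : ℕ) + 1) % m, Nat.mod_lt _ hm0⟩)
    (hblocks : ∀ i j : Fin m, aeval (z i) h = aeval (z j) h ↔ (i : ℕ) % r = (j : ℕ) % r)
    (i j : Fin m) (hij : i.val % r = j.val % r) :
    ∃ τ : L ≃ₐ[RatFunc ℂ] L, τ (z i) = z j ∧
      ∀ k : Fin m, k.val % r ≠ i.val % r → τ (z k) = z k := by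
  have hr : 0 < r := Nat.pos_of_mul_pos_left (hmr ▸ hm0)
  have hrm : r ∣ m := ⟨d, by rw [hmr, mul_comm]⟩
  have hpow := algEquiv_pow_apply_eq hm0 σ hσ
  have hcancel : ∀ a : ℕ, (i.val + a) % m = i.val → m ∣ a := fun a ha => by
    have h1 : i.val + a ≡ i.val + 0 [MOD m] := by
      rw [Nat.ModEq, ha, add_zero, Nat.mod_eq_of_lt i.2]
    exact (Nat.modEq_zero_iff_dvd).1 (Nat.ModEq.add_left_cancel' _ h1)
  have hs : ∀ k : ℕ, ((σ ^ r) ^ k) (z i) = z ⟨(i.val + r * k) % m, Nat.mod_lt _ hm0⟩ := fun k => by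
    rw [← pow_mul, hpow]
  have hs1 := hs 1
  have hs2 := hs 2
  rw [pow_one, mul_one] at hs1
  rw [pow_two, AlgEquiv.mul_apply] at hs2
  obtain ⟨k, hk⟩ : ∃ k, (i.val + r * k) % m = j.val := by
    have h1 : i.val ≤ j.val + m := by omega
    obtain ⟨k, hk⟩ : r ∣ j.val + m - i.val := by
      refine (Nat.modEq_iff_dvd' h1).1 ?_
      rw [Nat.ModEq, hij, Nat.add_mod, Nat.mod_eq_zero_of_dvd hrm, add_zero, Nat.mod_mod]
    refine ⟨k, ?_⟩
    rw [← hk, Nat.add_sub_cancel' h1, Nat.add_mod_right, Nat.mod_eq_of_lt j.2]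
  obtain ⟨τ, hτ, hfix⟩ := exists_algEquiv_fixing_pow hd hf (by omega) hcomp hhmc hmerge (hz i)
    (σ ^ r) (by rw [hs1, hblocks]; simp [Nat.mod_mod_of_dvd _ hrm])
    (fun e => by
      rw [hs1] at e
      have h1 := Nat.le_of_dvd hr (hcancel r (congrArg Fin.val (hzinj e)))
      nlinarith)
    (fun e => by
      rw [hs2] at e
      have h1 := Nat.le_of_dvd (by omega) (hcancel _ (congrArg Fin.val (hzinj e)))
      nlinarith) k
  refine ⟨τ, ?_, fun k hk => hfix _ (hz k) fun e => hk ((hblocks _ _).1 e)⟩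
  rw [hτ, hs]
  simp only [hk]

/-- for `f = f̃ ∘ h` with `h` a monomial `X^d` or the Chebyshev polynomial `T_d`,
non-merging critical values, and a balanced 0-cycle `C` of `f` whose imprimitivity blocks are
the residue classes mod `m/d`: (a) every `h`-invariant part of `C` is balanced; (b) `∫_C g = 0`
iff `g = (1/(d-1)) (g̃ ∘ h) + u` with `∫_{h(C)} g̃ = 0` and `∫_{C_l} u = 0` on every block. -/
theorem stmt_9 (m d r : ℕ) (f ftilde h : Polynomial ℂ)
    (hf : f.Monic) (hcomp : f = ftilde.comp h)
    (hhmc : h = Polynomial.X ^ d ∨ h = Polynomial.Chebyshev.T ℂ (d : ℤ))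
    (hd1 : 1 < d) (hm : f.natDegree = m) (hdm : d < m) (hmr : m = d * r)
    (L : Type) [Field L] [Algebra ℂ L] [Algebra (RatFunc ℂ) L]
    [IsScalarTower ℂ (RatFunc ℂ) L]
    (hsplit : Polynomial.IsSplittingField (RatFunc ℂ) L
      (f.map (algebraMap ℂ (RatFunc ℂ)) - Polynomial.C RatFunc.X))
    (z : Fin m → L) (hzinj : Function.Injective z)
    (hzroot : ∀ i : Fin m,
      Polynomial.aeval (z i) f = algebraMap (RatFunc ℂ) L RatFunc.X)
    (σinf : L ≃ₐ[RatFunc ℂ] L)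
    (hσinf : ∀ i : Fin m, σinf (z i) = z ⟨((i : ℕ) + 1) % m, Nat.mod_lt _ (by omega)⟩)
    (ε : ℂ) (hε : IsPrimitiveRoot ε m)
    (n : Fin m → ℤ) (hcycle : ∑ i : Fin m, n i = 0)
    (hbal : ∀ (σ : L ≃ₐ[RatFunc ℂ] L) (π : Equiv.Perm (Fin m)),
      (∀ i : Fin m, σ (z i) = z (π i)) →
      ∑ i : Fin m, ((n (π i) : ℂ)) * ε ^ ((i : ℕ) + 1) = 0)
    (hmerge : CriticalValuesDoNotMerge ftilde h)
    (hblocks : ∀ i j : Fin m,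
      Polynomial.aeval (z i) h = Polynomial.aeval (z j) h ↔ (i : ℕ) % r = (j : ℕ) % r)
    (εd : ℂ) (hεd : IsPrimitiveRoot εd d) :
    (∀ l < r, ∑ j ∈ Finset.range d,
        ((n ⟨(l + j * r) % m, Nat.mod_lt _ (by omega)⟩ : ℂ)) * εd ^ j = 0) ∧
    (∀ g : Polynomial ℂ,
      (∑ j : Fin m, algebraMap ℂ L ((n j : ℂ)) * Polynomial.aeval (z j) g = 0) ↔
      ∃ gt u : Polynomial ℂ,
        g = Polynomial.C (((d : ℂ) - 1)⁻¹) * (gt.comp h) + u ∧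
        (∑ j : Fin m, algebraMap ℂ L ((n j : ℂ)) *
          Polynomial.aeval (z j) (gt.comp h) = 0) ∧
        (∀ l < r, ∑ j ∈ Finset.range d,
          algebraMap ℂ L ((n ⟨(l + j * r) % m, Nat.mod_lt _ (by omega)⟩ : ℂ)) *
            Polynomial.aeval (z ⟨(l + j * r) % m, Nat.mod_lt _ (by omega)⟩) u = 0)) := by
  classical
  have hm0 : 0 < m := by omega
  have hr : 0 < r := Nat.pos_of_mul_pos_left (hmr ▸ hm0)
  have : FiniteDimensional (RatFunc ℂ) L := IsSplittingField.finiteDimensional L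
    (f.map (algebraMap ℂ (RatFunc ℂ)) - Polynomial.C RatFunc.X)
  have : IsGalois (RatFunc ℂ) L := isGalois_ratFunc_of_isSplittingField _ hsplit
  have : CharZero L := charZero_of_injective_algebraMap (algebraMap ℂ L).injective
  have hcard : ∀ l < r, (Finset.univ.filter fun i : Fin m => i.val % r = l).card = d :=
    fun l hl => by
      rw [Finset.card_eq_sum_ones, sum_filter_mod_eq_sum_range hmr hl hm0]
      simp
  have htrans := exists_algEquiv_fixing_of_mod_eq hd1 hmr hm0 hf hm hcomp hhmc hmerge hzinj
    hzroot σinf hσinf hblocks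
  have hd0 : (d : ℂ) ≠ 0 := by exact_mod_cast (by omega : d ≠ 0)
  have hd1' : (d : ℂ) - 1 ≠ 0 := sub_ne_zero.2 (by exact_mod_cast hd1.ne')
  refine ⟨fun l hl => ?_, fun g => ⟨fun hg => ?_, ?_⟩⟩
  · have hεr : IsPrimitiveRoot (ε ^ r) d := hε.pow hm0 (by rw [hmr, mul_comm])
    have hε0 : ε ≠ 0 := hε.ne_zero hm0.ne'
    have hpow : ∀ j ∈ Finset.range d, ε ^ ((l + j * r) % m + 1) = ε ^ (l + 1) * (ε ^ r) ^ j := by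
      intro j _
      rw [pow_succ, ← pow_eq_pow_mod _ hε.pow_eq_one, pow_add, pow_succ, ← pow_mul, mul_comm j r]
      ring
    refine sum_range_mul_pow_eq_zero_of_isPrimitiveRoot (by omega) hεr hεd
      (fun j => n ⟨(l + j * r) % m, Nat.mod_lt _ hm0⟩) ?_
    have h1 := card_mul_sum_filter_mod_eq hf hm hm0.ne' hzinj hzroot htrans
      (fun i => ε ^ (i.val + 1)) (fun i => (n i : ℂ))
      (fun σ π hσ => by simpa only [mul_comm] using hbal σ π hσ) l
    rw [hcard l hl, sum_filter_mod_eq_sum_range hmr hl hm0,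
      sum_filter_mod_eq_sum_range hmr hl hm0 fun i => ε ^ (i.val + 1),
      Finset.sum_congr rfl hpow, ← Finset.mul_sum, hεr.geom_sum_eq_zero hd1, mul_zero, zero_mul,
      mul_eq_zero, or_iff_right hd0] at h1
    refine mul_left_cancel₀ (pow_ne_zero (l + 1) hε0) ?_
    rw [mul_zero, ← h1, Finset.mul_sum]
    refine Finset.sum_congr rfl fun j hj => ?_
    rw [hpow j hj]
    ring
  · obtain ⟨G, hG⟩ := exists_forall_sum_fiber_eq_aeval (z := z) hf hcomp hm hm0.ne' hzinj hzroot
      (fun i j => ⟨σinf ^ (j.val + m - i.val), by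
        rw [algEquiv_pow_apply_eq hm0 σinf hσinf]
        congr 1
        apply Fin.ext
        simp only
        rw [Nat.add_sub_cancel' (by omega), Nat.add_mod_right, Nat.mod_eq_of_lt j.2]⟩) g
    simp only [hblocks] at hG
    have hI : ∀ l, ∀ hl : l < r, (d : L) *
        ∑ i : Fin m with i.val % r = l, algebraMap ℂ L (n i : ℂ) * aeval (z i) g =
        ∑ i : Fin m with i.val % r = l, algebraMap ℂ L (n i : ℂ) * aeval (z i) (G.comp h) := by
      intro l hl
      have h1 := card_mul_sum_filter_mod_eq hf hm hm0.ne' hzinj hzroot htrans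
        (fun i => algebraMap ℂ L (n i : ℂ)) (fun i => aeval (z i) g) (fun σ π hσ => by
          have h1 := congrArg σ hg
          simpa only [map_sum, map_mul, algEquiv_algebraMap_complex, ← aeval_algEquiv_apply, hσ,
            map_zero] using h1) l
      rw [hcard l hl] at h1
      rw [h1, Finset.sum_mul]
      refine Finset.sum_congr rfl fun i hi => ?_
      rw [← hG, (Finset.mem_filter.1 hi).2]
    have hgt : ∀ l < r, ∑ i : Fin m with i.val % r = l,
        algebraMap ℂ L (n i : ℂ) * aeval (z i) (((C (((d : ℂ) - 1) / d)) * G).comp h) =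
        algebraMap ℂ L ((d : ℂ) - 1) *
          ∑ i : Fin m with i.val % r = l, algebraMap ℂ L (n i : ℂ) * aeval (z i) g := by
      intro l hl
      have h1 := congrArg (algebraMap ℂ L (((d : ℂ) - 1) / d) * ·) (hI l hl)
      rw [← mul_assoc, ← map_natCast (algebraMap ℂ L) d, ← map_mul, div_mul_cancel₀ _ hd0] at h1
      rw [h1, Finset.mul_sum]
      refine Finset.sum_congr rfl fun i _ => ?_
      rw [mul_comp, C_comp, map_mul, aeval_C]
      ring
    refine ⟨C (((d : ℂ) - 1) / d) * G,
      g - C (((d : ℂ) - 1)⁻¹) * ((C (((d : ℂ) - 1) / d) * G).comp h), by ring, ?_, fun l hl => ?_⟩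
    · rw [sum_eq_sum_range_sum_filter_mod hr,
        Finset.sum_congr rfl fun l hl => hgt l (Finset.mem_range.1 hl), ← Finset.mul_sum,
        ← sum_eq_sum_range_sum_filter_mod hr, hg, mul_zero]
    · rw [← sum_filter_mod_eq_sum_range hmr hl hm0 fun i => algebraMap ℂ L (n i : ℂ) *
        aeval (z i) (g - C (((d : ℂ) - 1)⁻¹) * ((C (((d : ℂ) - 1) / d) * G).comp h))]
      have h1 := congrArg (algebraMap ℂ L ((d : ℂ) - 1)⁻¹ * ·) (hgt l hl)
      rw [← mul_assoc, ← map_mul, inv_mul_cancel₀ hd1', map_one, one_mul, ← sub_eq_zero,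
        ← neg_eq_zero, neg_sub, Finset.mul_sum, ← Finset.sum_sub_distrib] at h1
      rw [← h1]
      refine Finset.sum_congr rfl fun i _ => ?_
      rw [map_sub, map_mul, aeval_C]
      ring
  · rintro ⟨gt, u, rfl, hgt, hu⟩
    have h1 : ∑ i, algebraMap ℂ L (n i : ℂ) * aeval (z i) u = 0 := by
      rw [sum_eq_sum_range_sum_filter_mod hr]
      refine Finset.sum_eq_zero fun l hl => ?_
      rw [sum_filter_mod_eq_sum_range hmr (Finset.mem_range.1 hl) hm0]
      exact hu l (Finset.mem_range.1 hl)
    have h2 : ∑ i, algebraMap ℂ L (n i : ℂ) *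
        aeval (z i) (C (((d : ℂ) - 1)⁻¹) * gt.comp h) = 0 := by
      rw [← mul_zero (algebraMap ℂ L ((d : ℂ) - 1)⁻¹), ← hgt, Finset.mul_sum]
      refine Finset.sum_congr rfl fun i _ => ?_
      rw [map_mul, aeval_C]
      ring
    simp only [map_add, mul_add, Finset.sum_add_distrib]
    rw [h1, h2, add_zero]
end
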